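/- For every n ≥ 1 and all points p_1,…,p_n in general position in P^3, the radical ideal I = ∩_{j=1}^n m_{p_j} ⊆ k[P^3] of the n points satisfies I^(3r) ⊆ M^{2r}·I^r for all integers r ≥ 1. -/

import Mathlib

open MvPolynomial Filter

/-- The homogeneous ideal of all forms vanishing at the (projective) point with
coordinate vector `p`. -/
noncomputable def pointIdeal {k : Type*} [Field k] {σ : Type*} (p : σ → k) :
    Ideal (MvPolynomial σ k) :=
  Ideal.span { f | (∃ d, f.IsHomogeneous d) ∧ eval p f = 0 }

/-- The fat points ideal `⋂ⱼ m_{pⱼ}^{mⱼ}` (natural multiplicities). -/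
noncomputable def fatIdeal {k : Type*} [Field k] {N n : ℕ} (p : Fin n → (Fin (N + 1) → k))
    (m : Fin n → ℕ) : Ideal (MvPolynomial (Fin (N + 1)) k) :=
  ⨅ j, pointIdeal (p j) ^ (m j)

/-- The fat points ideal with integer multiplicities, with the convention
`m_p^m = (1)` for `m ≤ 0`. -/
noncomputable def fatIdealZ {k : Type*} [Field k] {N n : ℕ} (p : Fin n → (Fin (N + 1) → k))
    (m : Fin n → ℤ) : Ideal (MvPolynomial (Fin (N + 1)) k) :=
  ⨅ j, pointIdeal (p j) ^ (m j).toNat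

/-- The irrelevant maximal ideal `M = (x_0, …, x_N)`. -/
noncomputable def maxIdeal (k : Type*) [Field k] (N : ℕ) : Ideal (MvPolynomial (Fin (N + 1)) k) :=
  Ideal.span (Set.range X)

/-- `α(I)`: the least `t ≥ 0` such that `I` contains a nonzero form of degree `t`. -/
noncomputable def alpha {k : Type*} [Field k] {σ : Type*}
    (I : Ideal (MvPolynomial σ k)) : ℕ :=
  sInf { t | ∃ f ∈ I, f ≠ 0 ∧ f.IsHomogeneous t }

/-- The sequence `t ↦ α(I^{(t)})/t` attached to the fat points ideal with points `p`
and multiplicities `m`; its limit as `t → ∞` is the Waldschmidt constant `γ`. -/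
noncomputable def alphaSeq {k : Type*} [Field k] {N n : ℕ}
    (p : Fin n → (Fin (N + 1) → k)) (m : Fin n → ℕ) (t : ℕ) : ℝ :=
  (alpha (fatIdeal p fun j => t * m j) : ℝ) / t

/-- `P` holds for `n`-tuples of points of `P^N` in general position: there is a
nonempty Zariski-open subset (the complement of the zero locus of a set `S` of
polynomials in the coordinates of the tuple) of tuples of nonzero coordinate
vectors on which `P` holds. -/
def Generic (k : Type*) [Field k] (N n : ℕ)
    (P : (Fin n → (Fin (N + 1) → k)) → Prop) : Prop :=
  ∃ S : Set (MvPolynomial (Fin n × Fin (N + 1)) k),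
    (∃ p : Fin n → (Fin (N + 1) → k), (∀ j, p j ≠ 0) ∧
      ∃ f ∈ S, eval (fun q => p q.1 q.2) f ≠ 0) ∧
    ∀ p : Fin n → (Fin (N + 1) → k), (∀ j, p j ≠ 0) →
      (∃ f ∈ S, eval (fun q => p q.1 q.2) f ≠ 0) → P p

/-! ### Powers of ideals generated by variables -/

lemma mem_span_X_pow {σ R : Type*} [CommRing R] (A : Finset σ) (r : ℕ)
    (f : MvPolynomial σ R) :
    f ∈ Ideal.span (X '' (A : Set σ)) ^ r ↔ ∀ b ∈ f.support, r ≤ ∑ i ∈ A, b i := by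
  classical
  constructor
  · intro hf
    let K : ℕ → Submodule R (MvPolynomial σ R) := fun r =>
      restrictSupport R {b : σ →₀ ℕ | r ≤ ∑ i ∈ A, b i}
    have hK : ∀ r (g : MvPolynomial σ R), g ∈ K r ↔ ∀ b ∈ g.support, r ≤ ∑ i ∈ A, b i := by
      intro r g
      rw [mem_restrictSupport_iff]
      rfl
    have hmul : ∀ r s (g h : MvPolynomial σ R), g ∈ K r → h ∈ K s → g * h ∈ K (r + s) := by
      intro r s g h hg hh
      rw [hK] at *
      intro b hb
      have := support_mul g h hb
      obtain ⟨b1, h1, b2, h2, rfl⟩ := Finset.mem_add.mp this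
      have e1 := hg b1 h1
      have e2 := hh b2 h2
      simp only [Finsupp.add_apply, Finset.sum_add_distrib]
      omega
    have hall : ∀ g : MvPolynomial σ R, g ∈ K 0 := by
      intro g; rw [hK]; intros; omega
    have h1 : ∀ g ∈ Ideal.span (X '' (A : Set σ)), g ∈ K 1 := by
      intro g hg
      refine Submodule.span_induction ?_ (Submodule.zero_mem _)
        (fun _ _ _ _ h1 h2 => Submodule.add_mem _ h1 h2) ?_ hg
      · rintro x ⟨i, hi, rfl⟩
        rw [hK]
        intro b hb
        by_cases hR : Subsingleton R
        · exfalso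
          have : (X i : MvPolynomial σ R) = 0 := Subsingleton.elim _ _
          rw [this] at hb
          simp at hb
        · have : Nontrivial R := not_subsingleton_iff_nontrivial.mp hR
          rw [support_X, Finset.mem_singleton] at hb
          subst hb
          calc 1 = (Finsupp.single i 1 : σ →₀ ℕ) i := by simp
            _ ≤ _ := Finset.single_le_sum (f := fun j => (Finsupp.single i 1 : σ →₀ ℕ) j)
                (fun _ _ => Nat.zero_le _) hi
      · intro a x _ hx
        have := hmul 0 1 a x (hall a) hx
        simpa using this
    rw [← hK]
    clear hK
    induction r generalizing f with
    | zero => exact hall f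
    | succ r ih =>
      rw [pow_succ] at hf
      refine Submodule.mul_induction_on hf ?_ (fun _ _ h1 h2 => Submodule.add_mem _ h1 h2)
      intro m hm n hn
      exact hmul r 1 m n (ih m hm) (h1 n hn)
  · intro h
    rw [f.as_sum]
    refine Ideal.sum_mem _ fun b hb => ?_
    have hle := h b hb
    rw [monomial_eq]
    refine Ideal.mul_mem_left _ _ ?_
    have key : ∀ (s : Finset σ), (∏ i ∈ s, (X i : MvPolynomial σ R) ^ b i) ∈
        Ideal.span (X '' (A : Set σ)) ^ (∑ i ∈ A ∩ s, b i) := by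
      intro s
      induction s using Finset.induction_on with
      | empty => simp
      | insert i s hi ih =>
        rw [Finset.prod_insert hi]
        by_cases hA : i ∈ A
        · rw [Finset.inter_insert_of_mem hA, Finset.sum_insert (by simp [hi]), pow_add]
          exact Ideal.mul_mem_mul (Ideal.pow_mem_pow (Ideal.subset_span (Set.mem_image_of_mem _ hA)) _) ih
        · rw [Finset.inter_insert_of_notMem hA]
          exact Ideal.mul_mem_left _ _ ih
    have h2 := key b.support
    have e : ∑ i ∈ A ∩ b.support, b i = ∑ i ∈ A, b i := by
      apply Finset.sum_subset Finset.inter_subset_left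
      intro x hx hx2
      simp only [Finset.mem_inter, hx, true_and, Finsupp.mem_support_iff, not_not] at hx2
      exact hx2
    rw [e] at h2
    exact Ideal.pow_le_pow_right hle h2

lemma totalDegree_aeval_le_of_le_one {σ τ R : Type*} [CommRing R]
    (g : σ → MvPolynomial τ R) (hg : ∀ i, (g i).totalDegree ≤ 1) (f : MvPolynomial σ R) :
    (aeval g f).totalDegree ≤ f.totalDegree := by
  classical
  rw [aeval_def, eval₂_eq]
  refine (totalDegree_finsetSum _ _).trans ?_
  refine Finset.sup_le fun b hb => ?_
  refine (totalDegree_mul _ _).trans ?_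
  have h0 : (algebraMap R (MvPolynomial τ R) (coeff b f)).totalDegree = 0 := totalDegree_C _
  rw [h0, zero_add]
  refine (totalDegree_finsetProd _ _).trans ?_
  refine le_trans ?_ (le_totalDegree hb)
  rw [Finsupp.sum]
  refine Finset.sum_le_sum fun i _ => ?_
  refine (totalDegree_pow _ _).trans ?_
  have := Nat.mul_le_mul_left (b i) (hg i)
  simpa using this

/-! ### Affine multiplicity -/

/-- Translation by `p`. -/
noncomputable def shiftHom {σ R : Type*} [CommRing R] (p : σ → R) :
    MvPolynomial σ R →ₐ[R] MvPolynomial σ R := aeval (fun i => X i + C (p i))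

/-- The polynomial `f` vanishes to order at least `m` at `p`. -/
def Van {σ R : Type*} [CommRing R] (p : σ → R) (m : ℕ) (f : MvPolynomial σ R) : Prop :=
  ∀ b : σ →₀ ℕ, b.degree < m → coeff b (shiftHom p f) = 0

lemma van_iff {σ R : Type*} [Fintype σ] [CommRing R] (p : σ → R) (m : ℕ)
    (f : MvPolynomial σ R) :
    Van p m f ↔ shiftHom p f ∈ Ideal.span (X '' ((Finset.univ : Finset σ) : Set σ)) ^ m := by
  classical
  rw [mem_span_X_pow, Van]
  simp only [Finsupp.degree_eq_sum, mem_support_iff]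
  exact ⟨fun h b hb => not_lt.mp fun h' => hb (h b h'),
    fun h b hb => by_contra fun h' => absurd (h b h') (by omega)⟩

lemma shiftHom_shiftHom_neg {σ R : Type*} [CommRing R] (p : σ → R) (f : MvPolynomial σ R) :
    shiftHom (-p) (shiftHom p f) = f := by
  have : (shiftHom (-p)).comp (shiftHom p) = AlgHom.id R (MvPolynomial σ R) := by
    ext i; simp [shiftHom]
  exact congrArg (fun g => g f) this

lemma shiftHom_neg_shiftHom {σ R : Type*} [CommRing R] (p : σ → R) (f : MvPolynomial σ R) :
    shiftHom p (shiftHom (-p) f) = f := by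
  simpa using shiftHom_shiftHom_neg (-p) f

lemma Van.pow {σ R : Type*} [Fintype σ] [CommRing R] {p : σ → R} {m : ℕ}
    {f : MvPolynomial σ R} (h : Van p m f) (c : ℕ) : Van p (m * c) (f ^ c) := by
  rw [van_iff] at *
  rw [map_pow, pow_mul]
  exact Ideal.pow_mem_pow h c

lemma Van.mono {σ R : Type*} [CommRing R] {p : σ → R} {m m' : ℕ}
    {f : MvPolynomial σ R} (h : Van p m f) (hm : m' ≤ m) : Van p m' f :=
  fun b hb => h b (by omega)

/-! ### Degenerate configurations: peeling off hyperplanes -/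

/-- Restriction to the hyperplane `x_0 = z`. -/
noncomputable def resHom {k : Type*} [Field k] {N : ℕ} (z : k) :
    MvPolynomial (Fin (N + 1)) k →ₐ[k] MvPolynomial (Fin N) k :=
  aeval (Fin.cons (C z) X : Fin (N + 1) → MvPolynomial (Fin N) k)

lemma resHom_X_zero {k : Type*} [Field k] {N : ℕ} (z : k) :
    resHom (N := N) z (X 0) = C z := by simp [resHom]

lemma resHom_X_succ {k : Type*} [Field k] {N : ℕ} (z : k) (i : Fin N) :
    resHom (N := N) z (X i.succ) = X i := by simp [resHom]

lemma shiftHom_X {σ R : Type*} [CommRing R] (p : σ → R) (i : σ) :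
    shiftHom p (X i) = X i + C (p i) := by simp [shiftHom]

lemma shiftHom_C {σ R : Type*} [CommRing R] (p : σ → R) (c : R) :
    shiftHom p (C c) = C c := by simp [shiftHom]

lemma resHom_van {k : Type*} [Field k] {N : ℕ} (z : k) (p : Fin N → k) (m : ℕ)
    (f : MvPolynomial (Fin (N + 1)) k) (h : Van (Fin.cons z p : Fin (N + 1) → k) m f) :
    Van p m (resHom z f) := by
  rw [van_iff] at *
  have e : (shiftHom p).comp (resHom z) =
      (resHom (0 : k)).comp (shiftHom (Fin.cons z p : Fin (N + 1) → k)) := by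
    apply algHom_ext
    intro i
    refine Fin.cases ?_ (fun i => ?_) i
    · simp [resHom_X_zero, shiftHom_X]
    · simp [resHom_X_succ, shiftHom_X]
  have e2 : shiftHom p (resHom z f) =
      resHom (0 : k) (shiftHom (Fin.cons z p : Fin (N + 1) → k) f) :=
    congrArg (fun g => g f) e
  rw [e2]
  have h3 := Ideal.mem_map_of_mem (resHom (N := N) (0 : k)) h
  rw [Ideal.map_pow] at h3
  refine Ideal.pow_right_mono ?_ m h3
  rw [Ideal.map_span, Ideal.span_le]
  rintro _ ⟨_, ⟨i, _, rfl⟩, rfl⟩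
  refine Fin.cases ?_ (fun i => ?_) i
  · rw [resHom_X_zero]; simp
  · rw [resHom_X_succ]
    exact Ideal.subset_span (Set.mem_image_of_mem _ (by simp))

lemma dvd_of_resHom_eq_zero {k : Type*} [Field k] {N : ℕ} (z : k)
    (f : MvPolynomial (Fin (N + 1)) k) (h : resHom z f = 0) : (X 0 - C z) ∣ f := by
  rw [← Ideal.mem_span_singleton, ← Ideal.Quotient.eq_zero_iff_mem]
  set I := Ideal.span {(X 0 - C z : MvPolynomial (Fin (N + 1)) k)}
  have e : ((Ideal.Quotient.mkₐ k I).comp (rename Fin.succ)).comp (resHom z) =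
      Ideal.Quotient.mkₐ k I := by
    apply algHom_ext
    intro i
    refine Fin.cases ?_ (fun i => ?_) i
    · simp only [AlgHom.comp_apply, resHom_X_zero, rename_C]
      symm
      rw [← sub_eq_zero, ← map_sub]
      exact Ideal.Quotient.eq_zero_iff_mem.mpr (Ideal.subset_span rfl)
    · simp [resHom_X_succ]
  have e2 := congrArg (fun g => g f) e
  simp only [AlgHom.comp_apply, h, map_zero] at e2
  exact e2.symm

lemma van_div_on {k : Type*} [Field k] {N : ℕ} (q : Fin (N + 1) → k) (m : ℕ)
    (g : MvPolynomial (Fin (N + 1)) k) (h : Van q m ((X 0 - C (q 0)) * g)) :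
    Van q (m - 1) g := by
  intro b hb
  have := h (Finsupp.single 0 1 + b) (by simp; omega)
  rw [map_mul, map_sub, shiftHom_X, shiftHom_C, add_sub_cancel_right, coeff_X_mul] at this
  exact this

lemma van_div_off {k : Type*} [Field k] {N : ℕ} (q : Fin (N + 1) → k) (m : ℕ) (z : k)
    (hz : q 0 ≠ z)
    (g : MvPolynomial (Fin (N + 1)) k) (h : Van q m ((X 0 - C z) * g)) :
    Van q m g := by
  have key : ∀ D, ∀ b : Fin (N + 1) →₀ ℕ, b.degree = D → D < m →
      coeff b (shiftHom q g) = 0 := by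
    intro D
    induction D with
    | zero =>
      intro b hb hD
      have := h b (by omega)
      rw [map_mul, map_sub, shiftHom_X, shiftHom_C, add_sub_assoc, ← C_sub, add_mul, coeff_add,
        coeff_C_mul, coeff_X_mul'] at this
      have hb0 : b = 0 := (Finsupp.degree_eq_zero_iff b).mp hb
      subst hb0
      simpa [sub_ne_zero.mpr hz] using this
    | succ D ih =>
      intro b hb hD
      have := h b (by omega)
      rw [map_mul, map_sub, shiftHom_X, shiftHom_C, add_sub_assoc, ← C_sub, add_mul, coeff_add,
        coeff_C_mul, coeff_X_mul'] at this
      split_ifs at this with h0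
      · have hs : b = (b - Finsupp.single 0 1) + Finsupp.single 0 1 := by
          rw [tsub_add_cancel_of_le]
          rw [Finsupp.single_le_iff]
          have := Finsupp.mem_support_iff.mp h0
          omega
        have hd : (b - Finsupp.single 0 1).degree = D := by
          have := congrArg Finsupp.degree hs
          rw [map_add, hb] at this
          simp at this
          omega
        rw [ih _ hd (by omega)] at this
        simpa [sub_ne_zero.mpr hz] using this
      · simpa [sub_ne_zero.mpr hz] using this
  intro b hb
  exact key _ b rfl hb

/-- Lower bound for degrees: `c * m ≤ deg f` whenever `f ≠ 0` vanishes to order `m` on `T`. -/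
def WB {k : Type*} [Field k] {N : ℕ} (T : Set (Fin N → k)) (c : ℚ) : Prop :=
  ∀ f : MvPolynomial (Fin N) k, f ≠ 0 → ∀ m : ℕ, (∀ p ∈ T, Van p m f) →
    c * m ≤ (f.totalDegree : ℚ)

lemma layers_aux {k : Type*} [Field k] {N s : ℕ} (z : Fin s → k) (hz : Function.Injective z)
    (T : Fin s → Set (Fin N → k)) (a : Fin s → ℚ) (h : ∀ j, WB (T j) (a j))
    (ha : ∀ j, 0 < a j) :
    ∀ (D : ℕ) (f : MvPolynomial (Fin (N + 1)) k), f ≠ 0 → f.totalDegree = D → ∀ m : Fin s → ℕ,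
      (∀ j, ∀ p ∈ T j, Van (Fin.cons (z j) p : Fin (N + 1) → k) (m j) f) →
      ∃ δ : ℚ, 0 ≤ δ ∧ δ + ∑ j, max 0 ((m j : ℚ) - δ / a j) ≤ D := by
  classical
  intro D
  induction D using Nat.strong_induction_on with
  | _ D ih =>
  intro f hf hD m hm
  by_cases hc : ∀ j, a j * m j ≤ D
  · refine ⟨D, by positivity, ?_⟩
    have : ∀ j, max 0 ((m j : ℚ) - D / a j) = 0 := by
      intro j
      apply max_eq_left
      rw [sub_nonpos, le_div_iff₀ (ha j), mul_comm]
      exact hc j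
    simp [this]
  · push Not at hc
    obtain ⟨j, hj⟩ := hc
    have hres : resHom (z j) f = 0 := by
      by_contra hne
      have h1 := h j _ hne (m j) (fun p hp => resHom_van _ _ _ _ (hm j p hp))
      have h2 : (resHom (z j) f).totalDegree ≤ f.totalDegree := by
        apply totalDegree_aeval_le_of_le_one
        intro i
        refine Fin.cases ?_ (fun i => ?_) i
        · simp
        · simp
      have h3 : ((resHom (z j) f).totalDegree : ℚ) ≤ D := by exact_mod_cast hD ▸ h2
      linarith
    obtain ⟨g, hg⟩ := dvd_of_resHom_eq_zero _ _ hres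
    have hg0 : g ≠ 0 := by
      rintro rfl
      exact hf (by simpa using hg)
    have hdegl : (X 0 - C (z j) : MvPolynomial (Fin (N + 1)) k).totalDegree = 1 := by
      rw [sub_eq_add_neg, ← C_neg, totalDegree_add_eq_left_of_totalDegree_lt] <;> simp
    have hl0 : (X 0 - C (z j) : MvPolynomial (Fin (N + 1)) k) ≠ 0 := by
      intro h0
      rw [h0] at hdegl
      simp at hdegl
    have hdeg : f.totalDegree = 1 + g.totalDegree := by
      rw [hg, totalDegree_mul_of_isDomain hl0 hg0, hdegl]
    have hmj : 1 ≤ m j := by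
      by_contra hlt
      have : m j = 0 := by omega
      rw [this] at hj
      simp at hj
      exact absurd hj (not_lt.mpr (by positivity))
    obtain ⟨δ, hδ, hle⟩ := ih g.totalDegree (by omega) g hg0 rfl (Function.update m j (m j - 1)) (by
      intro i p hp
      have hv := hm i p hp
      rw [hg] at hv
      by_cases hij : i = j
      · subst hij
        rw [Function.update_self]
        exact van_div_on _ _ _ (by simpa using hv)
      · rw [Function.update_of_ne hij]
        exact van_div_off _ _ (z j) (by simpa using fun h => hij (hz h)) _ hv)
    refine ⟨δ, hδ, ?_⟩
    have h1 : ∑ i, max 0 ((m i : ℚ) - δ / a i) ≤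
        ∑ i, (max 0 (((Function.update m j (m j - 1)) i : ℚ) - δ / a i) + if i = j then 1 else 0) := by
      refine Finset.sum_le_sum fun i _ => ?_
      by_cases hij : i = j
      · subst hij
        rw [Function.update_self]
        push_cast [hmj]
        simp only [if_true]
        rcases le_total 0 ((m i : ℚ) - 1 - δ / a i) with h | h
        · rw [max_eq_right h]
          apply max_le <;> linarith
        · rw [max_eq_left h]
          apply max_le <;> linarith
      · rw [Function.update_of_ne hij]
        simp [hij]
    rw [Finset.sum_add_distrib] at h1
    simp only [Finset.sum_ite_eq', Finset.mem_univ, if_true] at h1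
    have : (D : ℚ) = 1 + g.totalDegree := by
      rw [← hD, hdeg]; push_cast; ring
    linarith

/-- There is a configuration of at most `n` points in affine `N`-space with bound `c`. -/
def HasCfg (k : Type*) [Field k] (N : ℕ) (c : ℚ) (n : ℕ) : Prop :=
  ∃ T : Finset (Fin N → k), T.card ≤ n ∧ WB (T : Set (Fin N → k)) c

lemma hasCfg_layers {k : Type*} [Field k] [CharZero k] {N s : ℕ} (a : Fin s → ℚ)
    (n : Fin s → ℕ) (ha : ∀ j, 0 < a j) (h : ∀ j, HasCfg k N (a j) (n j)) (c : ℚ)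
    (hc : ∀ m δ : ℚ, 0 ≤ m → 0 ≤ δ → c * m ≤ δ + ∑ j, max 0 (m - δ / a j)) :
    HasCfg k (N + 1) c (∑ j, n j) := by
  classical
  choose T hT hW using h
  refine ⟨Finset.univ.biUnion fun j => (T j).image
    (fun p => (Fin.cons ((j : ℕ) : k) p : Fin (N + 1) → k)), ?_, ?_⟩
  · refine Finset.card_biUnion_le.trans (Finset.sum_le_sum fun j _ => ?_)
    exact Finset.card_image_le.trans (hT j)
  · intro f hf m hm
    obtain ⟨δ, hδ, hle⟩ := layers_aux (fun j : Fin s => ((j : ℕ) : k))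
      (fun i j hij => Fin.ext (by simpa using hij)) (fun j => (T j : Set (Fin N → k))) a hW ha
      _ f hf rfl (fun _ => m) (by
        intro j p hp
        apply hm
        simp only [Finset.coe_biUnion, Set.mem_iUnion, Finset.coe_image]
        exact ⟨j, by simp, p, hp, rfl⟩)
    exact (hc m δ (by positivity) hδ).trans hle

lemma hasCfg_mono {k : Type*} [Field k] {N : ℕ} {c : ℚ} {n n' : ℕ} (h : HasCfg k N c n)
    (hn : n ≤ n') : HasCfg k N c n' := by
  obtain ⟨T, h1, h2⟩ := h
  exact ⟨T, h1.trans hn, h2⟩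

lemma hasCfg_box (k : Type*) [Field k] [CharZero k] (s : ℕ) (hs : 0 < s) (N : ℕ) :
    HasCfg k N s (s ^ N) := by
  induction N with
  | zero =>
    refine ⟨{default}, by simp, ?_⟩
    intro f hf m hm
    have hm0 : m = 0 := by
      by_contra hne
      apply hf
      have h1 := hm default (by simp)
      have h2 : shiftHom (default : Fin 0 → k) f = 0 := by
        ext b
        rw [h1 b (by rw [Subsingleton.elim b 0]; simp; omega)]
        simp
      have := shiftHom_shiftHom_neg (default : Fin 0 → k) f
      rw [h2, map_zero] at this
      exact this.symm
    subst hm0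
    simp
  | succ N ih =>
    have hs' : (0 : ℚ) < s := by exact_mod_cast hs
    have := hasCfg_layers (k := k) (N := N) (s := s) (fun _ => (s : ℚ)) (fun _ => s ^ N)
      (fun _ => hs') (fun _ => ih) s (by
        intro m δ hm hδ
        have : ∑ j : Fin s, (m - δ / s) ≤ ∑ j : Fin s, max 0 (m - δ / (s : ℚ)) :=
          Finset.sum_le_sum fun _ _ => le_max_right _ _
        rw [Finset.sum_const, Finset.card_univ, Fintype.card_fin, nsmul_eq_mul, mul_sub,
          mul_div_cancel₀ _ hs'.ne'] at this
        linarith)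
    simpa [pow_succ, mul_comm] using this

lemma hasCfg_six (k : Type*) [Field k] [CharZero k] : HasCfg k 2 (13 / 6) 6 := by
  have h := hasCfg_layers (k := k) (N := 1) (s := 3) ![3, 2, 1] ![3, 2, 1]
    (by intro j; fin_cases j <;> simp)
    (by
      intro j
      fin_cases j
      · simpa using hasCfg_box k 3 (by norm_num) 1
      · simpa using hasCfg_box k 2 (by norm_num) 1
      · simpa using hasCfg_box k 1 (by norm_num) 1) (13 / 6) (by
    intro m δ hm hδ
    simp only [Fin.sum_univ_three, Matrix.cons_val]
    have h1 := le_max_right 0 (m - δ / 3)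
    have h2 := le_max_right 0 (m - δ / 2)
    have h3 := le_max_right 0 (m - δ / 1)
    have h4 := le_max_left 0 (m - δ / 1)
    linarith)
  simpa [Fin.sum_univ_three] using h

lemma hasCfg_eleven (k : Type*) [Field k] [CharZero k] : HasCfg k 3 (53 / 26) 11 := by
  have h := hasCfg_layers (k := k) (N := 2) (s := 3) ![13 / 6, 2, 1] ![6, 4, 1]
    (by intro j; fin_cases j <;> simp)
    (by
      intro j
      fin_cases j
      · simpa using hasCfg_six k
      · simpa using hasCfg_box k 2 (by norm_num) 2
      · simpa using hasCfg_box k 1 (by norm_num) 2) (53 / 26) (by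
    intro m δ hm hδ
    simp only [Fin.sum_univ_three, Matrix.cons_val]
    have h1 := le_max_right 0 (m - δ / (13 / 6))
    have h2 := le_max_right 0 (m - δ / 2)
    have h3 := le_max_right 0 (m - δ / 1)
    have h4 := le_max_left 0 (m - δ / 1)
    linarith)
  simpa [Fin.sum_univ_three] using h

lemma hasCfg_twenty (k : Type*) [Field k] [CharZero k] : HasCfg k 3 (12 / 5) 20 := by
  have h := hasCfg_layers (k := k) (N := 2) (s := 4) ![3, 13 / 6, 2, 1] ![9, 6, 4, 1]
    (by intro j; fin_cases j <;> simp)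
    (by
      intro j
      fin_cases j
      · simpa using hasCfg_box k 3 (by norm_num) 2
      · simpa using hasCfg_six k
      · simpa using hasCfg_box k 2 (by norm_num) 2
      · simpa using hasCfg_box k 1 (by norm_num) 2) (12 / 5) (by
    intro m δ hm hδ
    simp only [Fin.sum_univ_four, Matrix.cons_val]
    have h1 := le_max_right 0 (m - δ / 3)
    have h2 := le_max_right 0 (m - δ / (13 / 6))
    have h3 := le_max_right 0 (m - δ / 2)
    have h3' := le_max_left 0 (m - δ / 2)
    have h4 := le_max_left 0 (m - δ / 1)
    linarith)
  simpa [Fin.sum_univ_four] using h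

lemma hasCfg_fifty (k : Type*) [Field k] [CharZero k] : HasCfg k 3 (7 / 2) 50 := by
  have h := hasCfg_layers (k := k) (N := 2) (s := 4) ![4, 4, 3, 3] ![16, 16, 9, 9]
    (by intro j; fin_cases j <;> simp)
    (by
      intro j
      fin_cases j
      · simpa using hasCfg_box k 4 (by norm_num) 2
      · simpa using hasCfg_box k 4 (by norm_num) 2
      · simpa using hasCfg_box k 3 (by norm_num) 2
      · simpa using hasCfg_box k 3 (by norm_num) 2) (7 / 2) (by
    intro m δ hm hδ
    simp only [Fin.sum_univ_four, Matrix.cons_val]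
    have h1 := le_max_right 0 (m - δ / 4)
    have h3 := le_max_right 0 (m - δ / 3)
    have h3' := le_max_left 0 (m - δ / 3)
    linarith)
  simpa [Fin.sum_univ_four] using h

/-! ### Cartier operators -/

section Cartier
variable {K : Type*} [Field K] (ℓ : ℕ) [Fact ℓ.Prime] [CharP K ℓ] [PerfectRing K ℓ] (e : ℕ)

/-- coordinatewise division of exponents -/
noncomputable def expDiv {σ : Type*} (q : ℕ) (a : σ →₀ ℕ) : σ →₀ ℕ :=
  a.mapRange (fun x => x / q) (by simp)

/-- coordinatewise remainder of exponents -/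
noncomputable def expMod {σ : Type*} (q : ℕ) (a : σ →₀ ℕ) : σ →₀ ℕ :=
  a.mapRange (fun x => x % q) (by simp)

lemma expDiv_apply {σ : Type*} (q : ℕ) (a : σ →₀ ℕ) (i : σ) : expDiv q a i = a i / q := rfl

lemma expMod_apply {σ : Type*} (q : ℕ) (a : σ →₀ ℕ) (i : σ) : expMod q a i = a i % q := rfl

lemma expDiv_add_expMod {σ : Type*} (q : ℕ) (a : σ →₀ ℕ) : q • expDiv q a + expMod q a = a := by
  ext i
  simp [expDiv_apply, expMod_apply, Nat.div_add_mod]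

/-- The Cartier operator attached to the exponent `b`. -/
noncomputable def cart {σ : Type*} (b : σ →₀ ℕ) (f : MvPolynomial σ K) : MvPolynomial σ K := by
  classical
  exact ∑ a ∈ f.support with expMod (ℓ ^ e) a = b,
    monomial (expDiv (ℓ ^ e) a) ((iterateFrobeniusEquiv K ℓ e).symm (coeff a f))

lemma coeff_cart {σ : Type*} (b : σ →₀ ℕ) (hb : ∀ i, b i < ℓ ^ e) (f : MvPolynomial σ K)
    (c : σ →₀ ℕ) : coeff c (cart ℓ e b f) =
      (iterateFrobeniusEquiv K ℓ e).symm (coeff (ℓ ^ e • c + b) f) := by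
  classical
  have hq : 0 < ℓ ^ e := pow_pos (Fact.out : ℓ.Prime).pos _
  rw [cart, coeff_sum]
  simp only [coeff_monomial]
  have hmod : expMod (ℓ ^ e) (ℓ ^ e • c + b) = b := by
    ext i; simp [expMod_apply, Nat.mod_eq_of_lt (hb i)]
  have hdiv : expDiv (ℓ ^ e) (ℓ ^ e • c + b) = c := by
    ext i
    simp only [expDiv_apply, Finsupp.add_apply, Finsupp.smul_apply, smul_eq_mul]
    rw [Nat.mul_add_div hq, Nat.div_eq_of_lt (hb i), add_zero]
  rw [Finset.sum_eq_single (ℓ ^ e • c + b)]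
  · rw [if_pos hdiv]
  · intro a ha hne
    rw [Finset.mem_filter] at ha
    rw [if_neg]
    intro h
    apply hne
    rw [← expDiv_add_expMod (ℓ ^ e) a, h, ha.2]
  · intro h
    rw [Finset.mem_filter, not_and] at h
    rw [if_pos hdiv]
    by_cases h0 : ℓ ^ e • c + b ∈ f.support
    · exact absurd hmod (h h0)
    · rw [notMem_support_iff.mp h0, map_zero]

lemma cart_add {σ : Type*} (b : σ →₀ ℕ) (hb : ∀ i, b i < ℓ ^ e) (f g : MvPolynomial σ K) :
    cart ℓ e b (f + g) = cart ℓ e b f + cart ℓ e b g := by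
  ext c
  simp only [coeff_add, coeff_cart ℓ e b hb, map_add]

lemma cart_zero {σ : Type*} (b : σ →₀ ℕ) :
    cart ℓ e b (0 : MvPolynomial σ K) = 0 := by
  simp [cart]

lemma cart_pow_mul {σ : Type*} (b : σ →₀ ℕ) (hb : ∀ i, b i < ℓ ^ e) (h f : MvPolynomial σ K) :
    cart ℓ e b (h ^ (ℓ ^ e) * f) = h * cart ℓ e b f := by
  classical
  have hq : 0 < ℓ ^ e := pow_pos (Fact.out : ℓ.Prime).pos _
  induction h using MvPolynomial.monomial_add_induction_on with
  | C a =>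
    ext c
    rw [← C_pow, coeff_C_mul, coeff_cart ℓ e b hb, coeff_cart ℓ e b hb, coeff_C_mul, map_mul]
    congr 1
    rw [RingEquiv.symm_apply_eq]
    simp [iterateFrobenius_def]
  | monomial_add a r g ha hr ih =>
    have : ExpChar (MvPolynomial σ K) ℓ := ExpChar.prime Fact.out
    rw [add_pow_expChar_pow, add_mul, cart_add ℓ e b hb, ih, add_mul]
    congr 1
    ext c
    rw [monomial_pow, coeff_monomial_mul', coeff_cart ℓ e b hb, coeff_monomial_mul']
    have : (ℓ ^ e • a ≤ ℓ ^ e • c + b) ↔ a ≤ c := by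
      constructor
      · intro h i
        have := h i
        simp only [Finsupp.add_apply, Finsupp.smul_apply, smul_eq_mul] at this
        have h2 : ℓ ^ e * a i < ℓ ^ e * (c i + 1) := by
          rw [mul_add]; have := hb i; omega
        have := Nat.lt_of_mul_lt_mul_left h2
        omega
      · intro h i
        have := Nat.mul_le_mul_left (ℓ ^ e) (h i)
        simp only [Finsupp.add_apply, Finsupp.smul_apply, smul_eq_mul]
        omega
    by_cases hac : a ≤ c
    · rw [if_pos (this.mpr hac), if_pos hac, coeff_cart ℓ e b hb, map_mul]
      congr 1
      · rw [RingEquiv.symm_apply_eq]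
        simp [iterateFrobenius_def]
      · congr 2
        ext i
        have h1 := hac i
        have h2 := Nat.mul_le_mul_left (ℓ ^ e) h1
        simp only [Finsupp.add_apply, Finsupp.smul_apply, smul_eq_mul, Finsupp.tsub_apply,
          Nat.mul_sub]
        omega
    · rw [if_neg (mt this.mp hac), if_neg hac, map_zero]

lemma exists_root_van {n : ℕ} (p : Fin n → Fin 3 → K) (m : ℕ) (f : MvPolynomial (Fin 3) K)
    (hf : f ≠ 0) (hv : ∀ j, Van (p j) ((m + 2) * ℓ ^ e) f) :
    ∃ g : MvPolynomial (Fin 3) K, g ≠ 0 ∧ ℓ ^ e * g.totalDegree ≤ f.totalDegree ∧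
      ∀ j, Van (p j) m g := by
  classical
  have hq : 0 < ℓ ^ e := pow_pos (Fact.out : ℓ.Prime).pos _
  obtain ⟨a, ha⟩ := support_nonempty.mpr hf
  set b := expMod (ℓ ^ e) a with hbdef
  have hb : ∀ i, b i < ℓ ^ e := fun i => by
    simp only [hbdef, expMod_apply]; exact Nat.mod_lt _ hq
  refine ⟨cart ℓ e b f, ?_, ?_, ?_⟩
  · intro h
    have : coeff (expDiv (ℓ ^ e) a) (cart ℓ e b f) = 0 := by rw [h, coeff_zero]
    rw [coeff_cart ℓ e b hb, hbdef, expDiv_add_expMod] at this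
    rw [mem_support_iff] at ha
    exact ha (by simpa using this)
  · by_cases h0 : cart ℓ e b f = 0
    · simp [h0]
    obtain ⟨c, hc, hcd⟩ := Finset.exists_mem_eq_sup _ (support_nonempty.mpr h0)
      (fun s : Fin 3 →₀ ℕ => s.sum fun _ x => x)
    rw [totalDegree, hcd]
    rw [mem_support_iff, coeff_cart ℓ e b hb] at hc
    have hc' : ℓ ^ e • c + b ∈ f.support := by
      rw [mem_support_iff]; intro h; apply hc; rw [h, map_zero]
    refine le_trans ?_ (le_totalDegree hc')
    have e1 : ∀ s : Fin 3 →₀ ℕ, (s.sum fun _ x => x) = ∑ i, s i := fun s =>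
      Finsupp.sum_fintype _ _ (by simp)
    rw [e1, e1, Finset.mul_sum]
    exact Finset.sum_le_sum fun i _ => by simp
  · intro j
    have hv := hv j
    rw [van_iff, mem_span_X_pow] at hv
    rw [van_iff]
    set F := shiftHom (p j) f with hF
    have hfF : f = shiftHom (-(p j)) F := by rw [hF, shiftHom_shiftHom_neg]
    have key : ∀ s : Finset (Fin 3 →₀ ℕ), s ⊆ F.support →
        shiftHom (p j) (cart ℓ e b (shiftHom (-(p j)) (∑ x ∈ s, monomial x (coeff x F)))) ∈
        Ideal.span (X '' ((Finset.univ : Finset (Fin 3)) : Set (Fin 3))) ^ m := by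
      intro s
      induction s using Finset.induction_on with
      | empty => intro _; simp [cart_zero]
      | insert x s hx ih =>
        intro hs
        rw [Finset.sum_insert hx, map_add, cart_add ℓ e b hb, map_add]
        refine Ideal.add_mem _ ?_ (ih fun y hy => hs (Finset.mem_insert_of_mem hy))
        have hxF := hv x (hs (Finset.mem_insert_self _ _))
        have e2 : (monomial x (coeff x F) : MvPolynomial (Fin 3) K) =
            (monomial (expDiv (ℓ ^ e) x) 1) ^ (ℓ ^ e) * monomial (expMod (ℓ ^ e) x) (coeff x F) := by
          rw [monomial_pow, monomial_mul, expDiv_add_expMod, one_pow, one_mul]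
        rw [e2, map_mul, map_pow, cart_pow_mul ℓ e b hb, map_mul, shiftHom_neg_shiftHom]
        refine Ideal.mul_mem_right _ _ ?_
        rw [mem_span_X_pow]
        intro y hy
        rw [support_monomial, if_neg one_ne_zero, Finset.mem_singleton] at hy
        subst hy
        simp only [Fin.sum_univ_three, expDiv_apply] at hxF ⊢
        have := Nat.div_add_mod (x 0) (ℓ ^ e)
        have := Nat.div_add_mod (x 1) (ℓ ^ e)
        have := Nat.div_add_mod (x 2) (ℓ ^ e)
        have := Nat.mod_lt (x 0) hq
        have := Nat.mod_lt (x 1) hq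
        have := Nat.mod_lt (x 2) hq
        have : ℓ ^ e * (m + 2) < ℓ ^ e * (x 0 / ℓ ^ e + x 1 / ℓ ^ e + x 2 / ℓ ^ e + 3) := by
          rw [mul_comm (m + 2)] at hxF
          simp only [mul_add]
          simp only [mul_add] at hxF
          omega
        have := Nat.lt_of_mul_lt_mul_left this
        omega
    have := key F.support subset_rfl
    rw [← as_sum, ← hfF] at this
    exact this

/-- no small polynomial vanishing to order `m` -/
def NoSmall {R : Type*} [CommRing R] {n : ℕ} (p : Fin n → Fin 3 → R) (m a : ℕ) : Prop :=
  ∀ f : MvPolynomial (Fin 3) R, f ≠ 0 → (∀ j, Van (p j) m f) → a ≤ f.totalDegree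

lemma NoSmall.char_p {n : ℕ} {p : Fin n → Fin 3 → K} {m a : ℕ} (ℓ : ℕ) [Fact ℓ.Prime]
    [CharP K ℓ] [PerfectRing K ℓ] (h : NoSmall p m a)
    (f : MvPolynomial (Fin 3) K) (hf : f ≠ 0) (M : ℕ) (hv : ∀ j, Van (p j) M f) :
    a * M ≤ (m + 2) * f.totalDegree := by
  rcases Nat.eq_zero_or_pos M with rfl | hM
  · simp
  by_contra hlt
  push Not at hlt
  have hl := (Fact.out : ℓ.Prime).one_lt
  set D := f.totalDegree with hD
  -- choose e large
  obtain ⟨e, he⟩ : ∃ e, M * D < ℓ ^ e := ⟨M * D, Nat.lt_pow_self hl⟩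
  set q := ℓ ^ e
  set c := ((m + 2) * q) / M + 1
  have hc1 : (m + 2) * q ≤ M * c := by
    have := Nat.div_add_mod ((m + 2) * q) M
    have := Nat.mod_lt ((m + 2) * q) hM
    simp only [c, mul_add]; omega
  have hc2 : M * c ≤ (m + 2) * q + M := by
    have := Nat.div_add_mod ((m + 2) * q) M
    simp only [c, mul_add]; omega
  obtain ⟨g, hg, hgd, hgv⟩ := exists_root_van ℓ e p m (f ^ c) (pow_ne_zero _ hf)
    (fun j => ((hv j).pow c).mono hc1)
  have h1 := h g hg hgv
  have h2 : (f ^ c).totalDegree ≤ c * D := totalDegree_pow _ _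
  have h3 : q * a ≤ c * D := (Nat.mul_le_mul_left q h1).trans (hgd.trans h2)
  have h4 : q * (a * M) ≤ ((m + 2) * q + M) * D := by
    calc q * (a * M) = (q * a) * M := by ring
      _ ≤ (c * D) * M := Nat.mul_le_mul_right _ h3
      _ = (M * c) * D := by ring
      _ ≤ _ := Nat.mul_le_mul_right _ hc2
  have h5 : q * ((m + 2) * D + 1) ≤ q * (a * M) := Nat.mul_le_mul_left _ hlt
  nlinarith
end Cartier

/-! ### Matrices of vanishing conditions -/

lemma map_shiftHom {σ R S : Type*} [CommRing R] [CommRing S] (φ : R →+* S) (p : σ → R)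
    (f : MvPolynomial σ R) :
    MvPolynomial.map φ (shiftHom p f) = shiftHom (fun i => φ (p i)) (MvPolynomial.map φ f) := by
  have : (MvPolynomial.map φ).comp (shiftHom p).toRingHom =
      (shiftHom (fun i => φ (p i))).toRingHom.comp (MvPolynomial.map φ) := by
    apply MvPolynomial.ringHom_ext
    · intro r; simp [shiftHom]
    · intro i; simp [shiftHom]
  exact congrArg (fun g => g f) this

instance degLT_finite (m : ℕ) : Finite {b : Fin 3 →₀ ℕ // b.degree < m} := by
  have := Finsupp.finite_of_degree_le (σ := Fin 3) m
  exact (this.subset (fun b (hb : b.degree < m) => hb.le)).to_subtype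

noncomputable instance degLT_fintype (m : ℕ) : Fintype {b : Fin 3 →₀ ℕ // b.degree < m} :=
  Fintype.ofFinite _

/-- The matrix of the vanishing conditions. -/
noncomputable def vanMat {R : Type*} [CommRing R] {n : ℕ} (p : Fin n → Fin 3 → R) (m a : ℕ) :
    Matrix (Fin n × {b : Fin 3 →₀ ℕ // b.degree < m}) {c : Fin 3 →₀ ℕ // c.degree < a} R :=
  fun r c => coeff r.2.1 (shiftHom (p r.1) (monomial c.1 1))

lemma vanMat_map {R S : Type*} [CommRing R] [CommRing S] (φ : R →+* S) {n : ℕ}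
    (p : Fin n → Fin 3 → R) (m a : ℕ) :
    (vanMat p m a).map φ = vanMat (fun j i => φ (p j i)) m a := by
  ext r c
  simp only [vanMat, Matrix.map_apply]
  rw [← coeff_map, map_shiftHom, map_monomial, map_one]

lemma degree_le_totalDegree {R : Type*} [CommRing R] {f : MvPolynomial (Fin 3) R}
    {b : Fin 3 →₀ ℕ} (h : b ∈ f.support) : b.degree ≤ f.totalDegree := by
  have := le_totalDegree h
  exact this

lemma vanMat_mulVec {R : Type*} [CommRing R] {n : ℕ} (p : Fin n → Fin 3 → R) (m a : ℕ)
    (f : MvPolynomial (Fin 3) R) (hf : f.totalDegree < a)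
    (r : Fin n × {b : Fin 3 →₀ ℕ // b.degree < m}) :
    (vanMat p m a).mulVec (fun c => coeff c.1 f) r = coeff r.2.1 (shiftHom (p r.1) f) := by
  classical
  have e : f = ∑ c : {c : Fin 3 →₀ ℕ // c.degree < a}, C (coeff c.1 f) * monomial c.1 1 := by
    ext d
    rw [coeff_sum]
    simp only [coeff_C_mul, coeff_monomial]
    by_cases hd : d.degree < a
    · rw [Finset.sum_eq_single ⟨d, hd⟩]
      · simp
      · intro b _ hb
        rw [if_neg, mul_zero]
        intro h; apply hb; exact Subtype.ext h
      · simp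
    · rw [Finset.sum_eq_zero]
      · by_contra h
        exact hd (lt_of_le_of_lt (degree_le_totalDegree (mem_support_iff.mpr h)) hf)
      · intro b _
        rw [if_neg, mul_zero]
        rintro rfl; exact hd b.2
  conv_rhs => rw [e]
  rw [map_sum, coeff_sum]
  simp only [Matrix.mulVec, dotProduct, vanMat, map_mul, shiftHom_C, coeff_C_mul]
  exact Finset.sum_congr rfl fun _ _ => mul_comm _ _

lemma noSmall_of_left_inv {R : Type*} [CommRing R] {n : ℕ} {p : Fin n → Fin 3 → R} {m a : ℕ}
    (B : Matrix {c : Fin 3 →₀ ℕ // c.degree < a} (Fin n × {b : Fin 3 →₀ ℕ // b.degree < m}) R)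
    (h : B * vanMat p m a = 1) : NoSmall p m a := by
  intro f hf hv
  by_contra hlt
  push Not at hlt
  apply hf
  have h0 : (vanMat p m a).mulVec (fun c => coeff c.1 f) = 0 := by
    ext r
    rw [vanMat_mulVec p m a f hlt]
    exact hv r.1 r.2.1 r.2.2
  have h1 : (fun c : {c : Fin 3 →₀ ℕ // c.degree < a} => coeff c.1 f) = 0 := by
    have := congrArg (fun v => B.mulVec v) h0
    simpa [Matrix.mulVec_mulVec, h] using this
  ext d
  by_cases hd : d.degree < a
  · exact congrFun h1 ⟨d, hd⟩
  · by_contra h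
    exact hd (lt_of_le_of_lt (degree_le_totalDegree (mem_support_iff.mpr h)) hlt)

lemma exists_left_inv_of_noSmall {R : Type*} [Field R] {n : ℕ} {p : Fin n → Fin 3 → R} {m a : ℕ}
    (h : NoSmall p m a) : ∃ B : Matrix {c : Fin 3 →₀ ℕ // c.degree < a}
      (Fin n × {b : Fin 3 →₀ ℕ // b.degree < m}) R, B * vanMat p m a = 1 := by
  classical
  have hker : LinearMap.ker (Matrix.toLin' (vanMat p m a)) = ⊥ := by
    rw [LinearMap.ker_eq_bot']
    intro v hv
    rw [Matrix.toLin'_apply] at hv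
    set f : MvPolynomial (Fin 3) R := ∑ c, C (v c) * monomial c.1 1 with hf
    have hcoef : ∀ c : {c : Fin 3 →₀ ℕ // c.degree < a}, coeff c.1 f = v c := by
      intro c
      rw [hf, coeff_sum]
      simp only [coeff_C_mul, coeff_monomial]
      rw [Finset.sum_eq_single c]
      · simp
      · intro b _ hb
        rw [if_neg, mul_zero]
        intro h; exact hb (Subtype.ext h)
      · simp
    have hsupp : ∀ d ∈ f.support, d.degree < a := by
      intro d hd
      by_contra hda
      rw [mem_support_iff, hf, coeff_sum] at hd
      apply hd
      apply Finset.sum_eq_zero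
      intro b _
      rw [coeff_C_mul, coeff_monomial, if_neg, mul_zero]
      rintro rfl; exact hda b.2
    by_contra hv0
    have hf0 : f ≠ 0 := by
      intro h0
      apply hv0
      ext c
      rw [← hcoef c, h0]; simp
    have hdeg : f.totalDegree < a := by
      obtain ⟨c, hc, hcd⟩ := Finset.exists_mem_eq_sup _ (support_nonempty.mpr hf0)
        (fun s : Fin 3 →₀ ℕ => s.sum fun _ x => x)
      rw [totalDegree, hcd]
      exact hsupp c hc
    have := h f hf0 (by
      intro j b hb
      rw [← vanMat_mulVec p m a f hdeg (j, ⟨b, hb⟩)]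
      have e : (fun c : {c : Fin 3 →₀ ℕ // c.degree < a} => coeff c.1 f) = v := funext hcoef
      rw [e, hv]; rfl)
    omega
  obtain ⟨g, hg⟩ := LinearMap.exists_leftInverse_of_injective _ hker
  refine ⟨LinearMap.toMatrix' g, ?_⟩
  have := congrArg LinearMap.toMatrix' hg
  rwa [LinearMap.toMatrix'_comp, LinearMap.toMatrix'_toLin', LinearMap.toMatrix'_id] at this

lemma noSmall_semicont {k : Type*} [Field k] {n : ℕ} {p0 : Fin n → Fin 3 → k} {m a : ℕ}
    (h : NoSmall p0 m a) : ∃ g : MvPolynomial (Fin n × Fin 3) k,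
      eval (fun q => p0 q.1 q.2) g ≠ 0 ∧
      ∀ p : Fin n → Fin 3 → k, eval (fun q => p q.1 q.2) g ≠ 0 → NoSmall p m a := by
  classical
  obtain ⟨B, hB⟩ := exists_left_inv_of_noSmall h
  let P : Fin n → Fin 3 → MvPolynomial (Fin n × Fin 3) k := fun j i => X (j, i)
  let B1 : Matrix {c : Fin 3 →₀ ℕ // c.degree < a} (Fin n × {b : Fin 3 →₀ ℕ // b.degree < m})
    (MvPolynomial (Fin n × Fin 3) k) := B.map C
  let Q : Matrix {c : Fin 3 →₀ ℕ // c.degree < a} {c : Fin 3 →₀ ℕ // c.degree < a}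
    (MvPolynomial (Fin n × Fin 3) k) := B1 * vanMat P m a
  have key : ∀ p : Fin n → Fin 3 → k,
      eval (fun q => p q.1 q.2) Q.det = (B * vanMat p m a).det := by
    intro p
    rw [RingHom.map_det]
    congr 1
    rw [RingHom.mapMatrix_apply, show Q = B1 * vanMat P m a from rfl, Matrix.map_mul, vanMat_map]
    congr 1
    · ext x y; simp [B1]
    · simp [P]
  refine ⟨Q.det, ?_, ?_⟩
  · rw [key, hB]; simp
  · intro p hp
    rw [key] at hp
    refine noSmall_of_left_inv ((B * vanMat p m a)⁻¹ * B) ?_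
    rw [Matrix.mul_assoc, Matrix.nonsing_inv_mul _ (isUnit_iff_ne_zero.mpr hp)]

/-! ### Reduction to positive characteristic -/

lemma isJacobsonRing_int : IsJacobsonRing ℤ := by
  rw [isJacobsonRing_iff_prime_eq]
  intro P hP
  by_cases h : P = ⊥
  · subst h
    rw [eq_bot_iff]
    intro x hx
    by_contra hx0
    rw [Ideal.mem_bot] at hx0
    obtain ⟨q, hq, hqp⟩ := Nat.exists_infinite_primes (x.natAbs + 1)
    rw [Ideal.jacobson, Ideal.mem_sInf] at hx
    have hmax : (Ideal.span {(q : ℤ)}).IsMaximal :=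
      PrincipalIdealRing.isMaximal_of_irreducible (Nat.prime_iff_prime_int.mp hqp).irreducible
    have := hx ⟨bot_le, hmax⟩
    rw [Ideal.mem_span_singleton] at this
    have := Int.natAbs_dvd_natAbs.mpr this
    have := Nat.le_of_dvd (Int.natAbs_pos.mpr hx0) this
    simp at this
    omega
  · have := Ideal.IsPrime.isMaximal hP h
    exact Ideal.jacobson_eq_self_of_isMaximal

lemma exists_perfect.{u} (F : Type u) [Field F] (ℓ : ℕ) [Fact ℓ.Prime] [CharP F ℓ] :
    ∃ (K : Type u) (_ : Field K) (_ : CharP K ℓ) (_ : PerfectRing K ℓ), Nonempty (F →+* K) := by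
  have : CharP (AlgebraicClosure F) ℓ :=
    charP_of_injective_algebraMap (algebraMap F _).injective ℓ
  exact ⟨AlgebraicClosure F, inferInstance, inferInstance, inferInstance, ⟨algebraMap F _⟩⟩

lemma exists_reduction.{u} {k : Type u} [Field k] (S : Finset k) :
    ∃ A0 : Subalgebra ℤ k, (S : Set k) ⊆ A0 ∧ ∃ (K : Type u) (_ : Field K) (ℓ : ℕ)
      (_ : Fact ℓ.Prime) (_ : CharP K ℓ) (_ : PerfectRing K ℓ), Nonempty (A0 →+* K) := by
  have := isJacobsonRing_int
  refine ⟨Algebra.adjoin ℤ (S : Set k), Algebra.subset_adjoin, ?_⟩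
  set A0 := Algebra.adjoin ℤ (S : Set k)
  have hft : Algebra.FiniteType ℤ A0 := by
    rw [← Subalgebra.fg_iff_finiteType]
    exact ⟨S, rfl⟩
  obtain ⟨I, hI⟩ := Ideal.exists_maximal A0
  let : Field (A0 ⧸ I) := Ideal.Quotient.field I
  have hft2 : Algebra.FiniteType ℤ (A0 ⧸ I) := inferInstance
  have hfin : Module.Finite ℤ (A0 ⧸ I) := finite_of_finite_type_of_isJacobsonRing ℤ (A0 ⧸ I)
  obtain ⟨ℓ, hℓ⟩ := CharP.exists (A0 ⧸ I)
  have hℓ0 : ℓ ≠ 0 := by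
    rintro rfl
    have : CharZero (A0 ⧸ I) := CharP.charP_to_charZero _
    have hint : Algebra.IsIntegral ℤ (A0 ⧸ I) := inferInstance
    have := isField_of_isIntegral_of_isField (R := ℤ) (S := A0 ⧸ I)
      (by intro a b h; simpa using h) (Field.toIsField _)
    exact Int.not_isField this
  have hpr : ℓ.Prime := (CharP.char_is_prime_or_zero (A0 ⧸ I) ℓ).resolve_right hℓ0
  have : Fact ℓ.Prime := ⟨hpr⟩
  obtain ⟨K, i1, i2, i3, ⟨ψ⟩⟩ := exists_perfect (A0 ⧸ I) ℓ
  exact ⟨K, i1, ℓ, inferInstance, i2, i3, ⟨ψ.comp (Ideal.Quotient.mk I)⟩⟩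

lemma NoSmall.char_zero {k : Type*} [Field k] {n : ℕ} {p : Fin n → Fin 3 → k} {m a : ℕ}
    (h : NoSmall p m a)
    (f : MvPolynomial (Fin 3) k) (hf : f ≠ 0) (M : ℕ) (hv : ∀ j, Van (p j) M f) :
    a * M ≤ (m + 2) * f.totalDegree := by
  classical
  obtain ⟨B, hB⟩ := exists_left_inv_of_noSmall h
  obtain ⟨c0, hc0⟩ := support_nonempty.mpr hf
  rw [mem_support_iff] at hc0
  let S : Finset k := (Finset.univ.image fun q : Fin n × Fin 3 => p q.1 q.2) ∪ f.coeffs ∪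
    (Finset.univ.image fun q : _ × _ => B q.1 q.2) ∪ {(coeff c0 f)⁻¹}
  obtain ⟨A0, hS, K, _, ℓ, _, _, _, ⟨φ⟩⟩ := exists_reduction S
  have hp : ∀ j i, p j i ∈ A0 := fun j i => hS (by
    simp only [S, Finset.coe_union, Set.mem_union]
    left; left; left
    exact Finset.mem_coe.mpr (Finset.mem_image.mpr ⟨(j, i), Finset.mem_univ _, rfl⟩))
  have hfc : (f.coeffs : Set k) ⊆ A0 := fun x hx => hS (by
    simp only [S, Finset.coe_union, Set.mem_union]
    left; left; right; exact hx)
  have hBc : ∀ i j, B i j ∈ A0 := fun i j => hS (by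
    simp only [S, Finset.coe_union, Set.mem_union]
    left; right
    exact Finset.mem_coe.mpr (Finset.mem_image.mpr ⟨(i, j), Finset.mem_univ _, rfl⟩))
  have hinv : (coeff c0 f)⁻¹ ∈ A0 := hS (by simp [S])
  let ι : A0 →+* k := A0.val.toRingHom
  have hι : Function.Injective ι := Subtype.val_injective
  let p' : Fin n → Fin 3 → A0 := fun j i => ⟨p j i, hp j i⟩
  let B' : Matrix {c : Fin 3 →₀ ℕ // c.degree < a}
      (Fin n × {b : Fin 3 →₀ ℕ // b.degree < m}) A0 := fun i j => ⟨B i j, hBc i j⟩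
  obtain ⟨f', hf'⟩ : ∃ f' : MvPolynomial (Fin 3) A0, map ι f' = f := by
    have : f ∈ Set.range (map ι : MvPolynomial (Fin 3) A0 →+* _) := by
      rw [mem_range_map_iff_coeffs_subset]
      intro x hx
      exact ⟨⟨x, hfc hx⟩, rfl⟩
    exact this
  have hB' : B' * vanMat p' m a = 1 := by
    have hinj : Function.Injective (fun A : Matrix {c : Fin 3 →₀ ℕ // c.degree < a}
        {c : Fin 3 →₀ ℕ // c.degree < a} A0 => A.map ι) := Matrix.map_injective hι
    apply hinj
    change (B' * vanMat p' m a).map ι = (1 : Matrix {c : Fin 3 →₀ ℕ // c.degree < a} {c : Fin 3 →₀ ℕ // c.degree < a} A0).map ι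
    rw [Matrix.map_mul, vanMat_map, Matrix.map_one _ (map_zero _) (map_one _)]
    exact hB
  have hK : NoSmall (fun j i => φ (p' j i)) m a := by
    refine noSmall_of_left_inv (B'.map φ) ?_
    rw [← vanMat_map, ← Matrix.map_mul, hB', Matrix.map_one _ (map_zero _) (map_one _)]
  have hcf : ι (coeff c0 f') = coeff c0 f := by rw [← coeff_map, hf']
  have hf'' : MvPolynomial.map φ f' ≠ 0 := by
    intro h0
    have h1 : φ (coeff c0 f') = 0 := by rw [← coeff_map, h0, coeff_zero]
    have h2 : coeff c0 f' * ⟨_, hinv⟩ = 1 := by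
      apply hι
      rw [map_mul, map_one, hcf]
      exact mul_inv_cancel₀ hc0
    have := congrArg φ h2
    rw [map_mul, h1, zero_mul, map_one] at this
    exact zero_ne_one this
  have hvan : ∀ j, Van (fun i => φ (p' j i)) M (MvPolynomial.map φ f') := by
    intro j b hb
    rw [← map_shiftHom, coeff_map]
    have : coeff b (shiftHom (p' j) f') = 0 := by
      apply hι
      rw [← coeff_map, map_shiftHom, hf', map_zero]
      exact hv j b hb
    rw [this, map_zero]
  have := NoSmall.char_p ℓ hK (MvPolynomial.map φ f') hf'' M hvan
  refine this.trans (Nat.mul_le_mul_left _ ?_)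
  refine (Finset.sup_mono (support_map_subset _ _)).trans ?_
  rw [← hf']
  rw [totalDegree, support_map_of_injective _ hι]

/-! ### Genericity -/

attribute [local instance] MvPolynomial.gradedAlgebra

/-- Genericity, in the form used below. -/
def Gen (k : Type*) [Field k] (N n : ℕ) (P : (Fin n → (Fin (N + 1) → k)) → Prop) : Prop :=
  ∃ g : MvPolynomial (Fin n × Fin (N + 1)) k, g ≠ 0 ∧
    ∀ p : Fin n → (Fin (N + 1) → k), eval (fun q => p q.1 q.2) g ≠ 0 → P p

lemma Gen.and {k : Type*} [Field k] {N n : ℕ} {P Q : (Fin n → (Fin (N + 1) → k)) → Prop}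
    (hP : Gen k N n P) (hQ : Gen k N n Q) : Gen k N n (fun p => P p ∧ Q p) := by
  obtain ⟨g, hg, h1⟩ := hP
  obtain ⟨g', hg', h2⟩ := hQ
  refine ⟨g * g', mul_ne_zero hg hg', fun p hp => ?_⟩
  rw [map_mul] at hp
  exact ⟨h1 p (left_ne_zero_of_mul hp), h2 p (right_ne_zero_of_mul hp)⟩

lemma Gen.mono {k : Type*} [Field k] {N n : ℕ} {P Q : (Fin n → (Fin (N + 1) → k)) → Prop}
    (hP : Gen k N n P) (h : ∀ p, P p → Q p) : Gen k N n Q := by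
  obtain ⟨g, hg, h1⟩ := hP
  exact ⟨g, hg, fun p hp => h p (h1 p hp)⟩

lemma exists_eval_ne_zero {k : Type*} [Field k] [Infinite k] {σ : Type*}
    (g : MvPolynomial σ k) (hg : g ≠ 0) : ∃ v, eval v g ≠ 0 := by
  by_contra h
  push Not at h
  exact hg (MvPolynomial.funext fun v => by rw [h v, map_zero])

lemma gen_zero_ne (k : Type*) [Field k] (N n : ℕ) :
    Gen k N n (fun p => ∀ j, p j 0 ≠ 0) := by
  refine ⟨∏ j, X (j, 0), Finset.prod_ne_zero_iff.mpr fun j _ => X_ne_zero _, fun p hp j => ?_⟩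
  rw [map_prod] at hp
  have := Finset.prod_ne_zero_iff.mp hp j (Finset.mem_univ _)
  simpa using this

lemma Gen.generic {k : Type*} [Field k] [Infinite k] {N n : ℕ}
    {P : (Fin n → (Fin (N + 1) → k)) → Prop} (hP : Gen k N n P) : Generic k N n P := by
  obtain ⟨g, hg, h⟩ := hP.and (gen_zero_ne k N n)
  obtain ⟨v, hv⟩ := exists_eval_ne_zero g hg
  refine ⟨{g}, ⟨fun j i => v (j, i), ?_, g, rfl, hv⟩, ?_⟩
  · intro j hj
    have := (h (fun j i => v (j, i)) hv).2 j
    exact this (congrFun hj 0)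
  · rintro p - ⟨f, rfl, hf⟩
    exact (h p hf).1

lemma exists_homogenization {k : Type*} [Field k] {n N : ℕ} (g : MvPolynomial (Fin n × Fin N) k) :
    ∃ (G : MvPolynomial (Fin n × Fin (N + 1)) k) (D : ℕ), ∀ p : Fin n → Fin (N + 1) → k,
      (∀ j, p j 0 ≠ 0) → eval (fun q => p q.1 q.2) G =
        (∏ j, p j 0) ^ D * eval (fun q => p q.1 q.2.succ / p q.1 0) g := by
  classical
  induction g using MvPolynomial.induction_on with
  | C a => exact ⟨C a, 0, fun p hp => by simp⟩
  | add f g hf hg =>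
    obtain ⟨F, D, hF⟩ := hf
    obtain ⟨G, E, hG⟩ := hg
    refine ⟨F * (∏ j, X (j, 0)) ^ E + G * (∏ j, X (j, 0)) ^ D, D + E, fun p hp => ?_⟩
    rw [map_add, map_mul, map_mul, hF p hp, hG p hp]
    simp only [map_pow, map_prod, eval_X, map_add]
    ring
  | mul_X f q hf =>
    obtain ⟨F, D, hF⟩ := hf
    refine ⟨F * (X (q.1, q.2.succ) * ∏ j ∈ Finset.univ.erase q.1, X (j, 0)), D + 1, fun p hp => ?_⟩
    rw [map_mul, hF p hp]
    simp only [map_mul, map_prod, eval_X]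
    rw [pow_succ, ← Finset.mul_prod_erase Finset.univ (fun j => p j 0) (Finset.mem_univ q.1)]
    field_simp [hp q.1]

lemma gen_affine {k : Type*} [Field k] [Infinite k] {n N : ℕ} (g : MvPolynomial (Fin n × Fin N) k)
    (hg : g ≠ 0) : Gen k N n (fun p => (∀ j, p j 0 ≠ 0) ∧
      eval (fun q => p q.1 q.2.succ / p q.1 0) g ≠ 0) := by
  obtain ⟨G, D, hG⟩ := exists_homogenization g
  have hG0 : Gen k N n (fun p => eval (fun q => p q.1 q.2) G ≠ 0) := by
    refine ⟨G, ?_, fun p hp => hp⟩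
    rintro rfl
    obtain ⟨v, hv⟩ := exists_eval_ne_zero g hg
    have := hG (fun j => Fin.cons 1 fun i => v (j, i)) (by simp)
    simp at this
    exact hv this.symm
  refine ((gen_zero_ne k N n).and hG0).mono fun p hp => ⟨hp.1, fun h => hp.2 ?_⟩
  rw [hG p hp.1, h, mul_zero]

/-! ### Homogeneity -/

lemma hc_mul_homog {k σ : Type*} [CommRing k] (r g : MvPolynomial σ k) {a : ℕ}
    (hg : g.IsHomogeneous a) (t : ℕ) : homogeneousComponent t (r * g) =
      if a ≤ t then homogeneousComponent (t - a) r * g else 0 := by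
  classical
  conv_lhs => rw [← sum_homogeneousComponent r, Finset.sum_mul, map_sum]
  have h1 : ∀ i, homogeneousComponent t (homogeneousComponent i r * g) =
      if t = i + a then homogeneousComponent i r * g else 0 := fun i =>
    homogeneousComponent_of_mem ((homogeneousComponent_isHomogeneous i r).mul hg)
  simp only [h1]
  split_ifs with hat
  · by_cases hs : t - a ∈ Finset.range (r.totalDegree + 1)
    · rw [Finset.sum_eq_single_of_mem (t - a) hs]
      · rw [if_pos (by omega)]
      · intro b _ hb
        rw [if_neg (by omega)]
    · rw [homogeneousComponent_eq_zero (t - a) r (by rw [Finset.mem_range] at hs; omega), zero_mul]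
      apply Finset.sum_eq_zero
      intro b hb
      rw [if_neg]
      rintro rfl
      apply hs
      simpa using hb
  · apply Finset.sum_eq_zero
    intro b hb
    rw [if_neg (by omega)]

lemma graded_span_induction {k σ : Type*} [CommRing k] {G : Set (MvPolynomial σ k)}
    {F : MvPolynomial σ k} {t : ℕ} (Pr : MvPolynomial σ k → Prop)
    (hG : ∀ g ∈ G, ∃ a, g.IsHomogeneous a)
    (zero : Pr 0) (add : ∀ x y, Pr x → Pr y → Pr (x + y))
    (mul : ∀ g ∈ G, ∀ a, g.IsHomogeneous a → a ≤ t → ∀ h : MvPolynomial σ k,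
      h.IsHomogeneous (t - a) → Pr (h * g))
    (hF : F ∈ Ideal.span G) (hFt : F.IsHomogeneous t) : Pr F := by
  classical
  have key : ∀ F ∈ Ideal.span G, Pr (homogeneousComponent t F) := by
    intro F hF
    refine Submodule.closure_induction ?_ ?_ ?_ hF
    · rw [map_zero]; exact zero
    · intro x y _ _ hx hy
      rw [map_add]; exact add _ _ hx hy
    · intro r x hx
      obtain ⟨a, ha⟩ := hG x hx
      rw [smul_eq_mul, hc_mul_homog r x ha]
      split_ifs with h
      · exact mul x hx a ha h _ (homogeneousComponent_isHomogeneous _ _)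
      · exact zero
  have := key F hF
  rwa [homogeneousComponent_eq_self hFt] at this

lemma eval_smul_homog {k σ : Type*} [Field k] {f : MvPolynomial σ k} {d : ℕ}
    (hf : f.IsHomogeneous d) (c : k) (p : σ → k) : eval (c • p) f = c ^ d * eval p f := by
  classical
  rw [eval_eq, eval_eq, Finset.mul_sum]
  refine Finset.sum_congr rfl fun b hb => ?_
  have hd : b.degree = d := by
    by_contra h
    exact (mem_support_iff.mp hb) (hf.coeff_eq_zero h)
  simp only [Pi.smul_apply, smul_eq_mul, mul_pow, Finset.prod_mul_distrib]
  rw [Finset.prod_pow_eq_pow_sum]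
  have : ∑ i ∈ b.support, b i = d := by rw [← hd]; rfl
  rw [this]; ring

lemma pointIdeal_smul {k σ : Type*} [Field k] (p : σ → k) {c : k} (hc : c ≠ 0) :
    pointIdeal (c • p) = pointIdeal p := by
  unfold pointIdeal
  congr 1
  ext f
  constructor
  · rintro ⟨⟨d, hd⟩, h⟩
    refine ⟨⟨d, hd⟩, ?_⟩
    rw [eval_smul_homog hd] at h
    exact (mul_eq_zero.mp h).resolve_left (pow_ne_zero _ hc)
  · rintro ⟨⟨d, hd⟩, h⟩
    refine ⟨⟨d, hd⟩, ?_⟩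
    rw [eval_smul_homog hd, h, mul_zero]

lemma pointIdeal_pow_homog {k σ : Type*} [Field k] (p : σ → k) (m : ℕ) :
    (pointIdeal p ^ m).IsHomogeneous (homogeneousSubmodule σ k) := by
  induction m with
  | zero => rw [pow_zero, Ideal.one_eq_top]; exact Ideal.IsHomogeneous.top _
  | succ m ih =>
    rw [pow_succ]
    refine ih.mul (Ideal.homogeneous_span _ _ ?_)
    rintro x ⟨⟨d, hd⟩, -⟩
    exact ⟨d, hd⟩

lemma fatIdeal_homog {k : Type*} [Field k] {N n : ℕ} (p : Fin n → (Fin (N + 1) → k))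
    (m : Fin n → ℕ) : (fatIdeal p m).IsHomogeneous (homogeneousSubmodule (Fin (N + 1)) k) :=
  Ideal.IsHomogeneous.iInf fun j => pointIdeal_pow_homog (p j) (m j)

lemma le_of_homog {k σ : Type*} [Field k] {I J : Ideal (MvPolynomial σ k)}
    (hI : I.IsHomogeneous (homogeneousSubmodule σ k))
    (h : ∀ F ∈ I, ∀ t, F.IsHomogeneous t → F ∈ J) : I ≤ J := by
  intro f hf
  rw [← sum_homogeneousComponent f]
  exact Ideal.sum_mem _ fun t _ => h _ (homogeneousComponent_mem_of_mem hI hf t) t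
    (homogeneousComponent_isHomogeneous t f)

/-! ### Coordinates -/

lemma eval_single_homog {k σ : Type*} [Field k] [Fintype σ] [DecidableEq σ]
    {f : MvPolynomial σ k} {d : ℕ}
    (hf : f.IsHomogeneous d) (j : σ) :
    eval (Pi.single j 1) f = coeff (Finsupp.single j d) f := by
  rw [eval_eq']
  have h1 : ∀ b ∈ f.support, b ≠ Finsupp.single j d →
      coeff b f * ∏ i, (Pi.single j (1 : k) : σ → k) i ^ b i = 0 := by
    intro b hb hne
    have hd : b.degree = d := by
      by_contra h
      exact (mem_support_iff.mp hb) (hf.coeff_eq_zero h)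
    have : ∃ i, i ≠ j ∧ b i ≠ 0 := by
      by_contra hcon
      push Not at hcon
      apply hne
      have hb' : b = Finsupp.single j (b j) := by
        ext i
        by_cases hi : i = j
        · subst hi; simp
        · rw [hcon i hi, Finsupp.single_eq_of_ne hi]
      rw [hb', Finsupp.degree_single] at hd
      rw [hb', hd]
    obtain ⟨i, hij, hbi⟩ := this
    rw [Finset.prod_eq_zero (Finset.mem_univ i), mul_zero]
    rw [Pi.single_eq_of_ne hij, zero_pow hbi]
  by_cases hs : Finsupp.single j d ∈ f.support
  · rw [Finset.sum_eq_single_of_mem _ hs h1]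
    rw [Finset.prod_eq_one, mul_one]
    intro i _
    by_cases hi : i = j
    · subst hi; simp
    · rw [Finsupp.single_eq_of_ne hi, pow_zero]
  · rw [notMem_support_iff.mp hs]
    exact Finset.sum_eq_zero fun b hb => h1 b hb (by rintro rfl; exact hs hb)

lemma pointIdeal_single {k σ : Type*} [Field k] [Fintype σ] [DecidableEq σ] (j : σ) :
    pointIdeal (Pi.single j (1 : k)) =
      Ideal.span (X '' ((Finset.univ.erase j : Finset σ) : Set σ)) := by
  apply le_antisymm
  · rw [pointIdeal, Ideal.span_le]
    rintro f ⟨⟨d, hd⟩, h⟩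
    rw [SetLike.mem_coe, ← pow_one (Ideal.span _), mem_span_X_pow]
    intro b hb
    by_contra hlt
    have h0 : ∑ i ∈ Finset.univ.erase j, b i = 0 := by omega
    rw [Finset.sum_eq_zero_iff] at h0
    have hb' : b = Finsupp.single j (b j) := by
      ext i
      by_cases hi : i = j
      · subst hi; simp
      · rw [h0 i (by simp [hi]), Finsupp.single_eq_of_ne hi]
    have hdeg : b.degree = d := by
      by_contra h
      exact (mem_support_iff.mp hb) (hd.coeff_eq_zero h)
    rw [hb', Finsupp.degree_single] at hdeg
    rw [eval_single_homog hd j] at h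
    rw [hb', hdeg, mem_support_iff] at hb
    exact hb h
  · rw [Ideal.span_le]
    rintro _ ⟨i, hi, rfl⟩
    refine Ideal.subset_span ⟨⟨1, isHomogeneous_X _ _⟩, ?_⟩
    have : i ≠ j := by simpa using hi
    simp [this]

lemma mem_pointIdeal_pow_iff {k σ : Type*} [Field k] [Fintype σ] [DecidableEq σ]
    (τ : MvPolynomial σ k ≃ₐ[k] MvPolynomial σ k)
    (h1 : ∀ i, (τ (X i)).IsHomogeneous 1) (h2 : ∀ i, (τ.symm (X i)).IsHomogeneous 1)
    (p : σ → k) (j : σ) (he : ∀ i, eval (Pi.single j 1) (τ (X i)) = p i) (r : ℕ)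
    (F : MvPolynomial σ k) : F ∈ pointIdeal p ^ r ↔
      ∀ b ∈ (τ F).support, r ≤ ∑ i ∈ Finset.univ.erase j, b i := by
  have hh : ∀ (υ : MvPolynomial σ k ≃ₐ[k] MvPolynomial σ k),
      (∀ i, (υ (X i)).IsHomogeneous 1) → ∀ f d, f.IsHomogeneous d → (υ f).IsHomogeneous d := by
    intro υ hυ f d hf
    have e : υ f = aeval (fun i => υ (X i)) f := by
      have : (υ : MvPolynomial σ k →ₐ[k] MvPolynomial σ k) = aeval (fun i => υ (X i)) := by
        ext i; simp
      exact congrArg (fun g => g f) this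
    rw [e]
    have := hf.aeval (fun i => υ (X i)) hυ
    rwa [one_mul] at this
  have hev : ∀ f, eval (Pi.single j 1) (τ f) = eval p f := by
    intro f
    have : (aeval (Pi.single j (1 : k))).comp (τ : MvPolynomial σ k →ₐ[k] MvPolynomial σ k) =
        aeval p := by
      ext i; simp [← he i, aeval_eq_eval]
    exact congrArg (fun g => g f) this
  have hmap : Ideal.map (τ : MvPolynomial σ k →+* MvPolynomial σ k) (pointIdeal p) =
      pointIdeal (Pi.single j (1 : k)) := by
    rw [pointIdeal, Ideal.map_span, pointIdeal]
    congr 1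
    ext f
    constructor
    · rintro ⟨g, ⟨⟨d, hd⟩, hg⟩, rfl⟩
      exact ⟨⟨d, hh τ h1 g d hd⟩, (hev g).trans hg⟩
    · rintro ⟨⟨d, hd⟩, hf⟩
      refine ⟨τ.symm f, ⟨⟨d, hh τ.symm h2 f d hd⟩, ?_⟩, by simp⟩
      rw [← hev]; simpa using hf
  rw [← mem_span_X_pow, ← pointIdeal_single, ← hmap, ← Ideal.map_pow]
  constructor
  · intro h; exact Ideal.mem_map_of_mem _ h
  · intro h
    obtain ⟨x, hx, e⟩ := (Ideal.mem_map_of_equiv (τ : MvPolynomial σ k ≃+* MvPolynomial σ k) _).mp h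
    have : x = F := τ.injective e
    rwa [← this]

/-! ### Exponent combinatorics -/

lemma exists_le_degree {σ : Type*} (l : σ →₀ ℕ) (A : ℕ) (h : A ≤ l.degree) :
    ∃ u v : σ →₀ ℕ, u + v = l ∧ u.degree = A := by
  classical
  induction A with
  | zero => exact ⟨0, l, by simp, by simp⟩
  | succ A ih =>
    obtain ⟨u, v, h1, h2⟩ := ih (by omega)
    have hv : v ≠ 0 := by
      rintro rfl
      rw [add_zero] at h1
      subst h1
      omega
    obtain ⟨c, hc⟩ := Finsupp.support_nonempty_iff.mpr hv
    rw [Finsupp.mem_support_iff] at hc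
    refine ⟨u + Finsupp.single c 1, v - Finsupp.single c 1, ?_, ?_⟩
    · rw [← h1, add_assoc]
      congr 1
      exact add_tsub_cancel_of_le (Finsupp.single_le_iff.mpr (by omega))
    · rw [map_add, Finsupp.degree_single, h2]

lemma exists_single_add {σ : Type*} (v : σ →₀ ℕ) (i : σ) (h : v i ≠ 0) :
    ∃ w, v = w + Finsupp.single i 1 ∧ v.degree = w.degree + 1 := by
  have h1 : v = (v - Finsupp.single i 1) + Finsupp.single i 1 :=
    (tsub_add_cancel_of_le (Finsupp.single_le_iff.mpr (by omega))).symm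
  refine ⟨_, h1, ?_⟩
  conv_lhs => rw [h1]
  rw [map_add, Finsupp.degree_single]

lemma swap_connect {σ : Type*} [Fintype σ] (rel : (σ →₀ ℕ) × (σ →₀ ℕ) → (σ →₀ ℕ) × (σ →₀ ℕ) → Prop)
    (hrefl : ∀ x, rel x x) (htr : ∀ x y z, rel x y → rel y z → rel x z) (A B : ℕ)
    (hswap : ∀ u v i j, u.degree + 1 = A → v.degree + 1 = B →
      rel (u + Finsupp.single i 1, v + Finsupp.single j 1)
        (u + Finsupp.single j 1, v + Finsupp.single i 1))
    (u v u' v' : σ →₀ ℕ) (hu : u.degree = A) (hv : v.degree = B) (hu' : u'.degree = A)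
    (h : u + v = u' + v') : rel (u, v) (u', v') := by
  classical
  obtain ⟨D, hD⟩ : ∃ D, D = ∑ i, (u i - u' i) := ⟨_, rfl⟩
  induction D using Nat.strong_induction_on generalizing u v with
  | _ D ih =>
  by_cases huu : u = u'
  · subst huu
    rw [add_left_cancel h]
    exact hrefl _
  have hsum : ∑ i, u i = ∑ i, u' i := by
    rw [← Finsupp.degree_eq_sum, ← Finsupp.degree_eq_sum, hu, hu']
  have h1 : ∃ i, u' i < u i := by
    by_contra hcon
    push Not at hcon
    apply huu
    ext i
    exact ((Finset.sum_eq_sum_iff_of_le fun i _ => hcon i).mp hsum) i (Finset.mem_univ _)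
  have h2 : ∃ j, u j < u' j := by
    by_contra hcon
    push Not at hcon
    apply huu
    ext i
    exact (((Finset.sum_eq_sum_iff_of_le fun i _ => hcon i).mp hsum.symm) i (Finset.mem_univ _)).symm
  obtain ⟨i, hi⟩ := h1
  obtain ⟨j, hj⟩ := h2
  have hij : i ≠ j := by rintro rfl; omega
  have hvj : v j ≠ 0 := by
    have := congrArg (fun f => f j) h
    simp only [Finsupp.add_apply] at this
    omega
  obtain ⟨w, hw, hwd⟩ := exists_single_add u i (by omega)
  obtain ⟨z, hz, hzd⟩ := exists_single_add v j hvj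
  have s1 := hswap w z i j (by omega) (by omega)
  rw [← hw, ← hz] at s1
  refine htr _ _ _ s1 ?_
  refine ih _ ?_ _ _ ?_ ?_ ?_ rfl
  · rw [hD]
    apply Finset.sum_lt_sum
    · intro x _
      have : u x = w x + (Finsupp.single i 1 : σ →₀ ℕ) x := by rw [hw]; rfl
      simp only [Finsupp.add_apply]
      by_cases hx : x = j
      · subst hx
        rw [Finsupp.single_eq_of_ne hij.symm] at this
        simp only [Finsupp.single_eq_same]
        omega
      · rw [Finsupp.single_eq_of_ne hx]
        omega
    · refine ⟨i, Finset.mem_univ _, ?_⟩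
      have : u i = w i + 1 := by rw [hw]; simp
      simp only [Finsupp.add_apply]
      rw [Finsupp.single_eq_of_ne hij]
      omega
  · rw [map_add, Finsupp.degree_single]; omega
  · rw [map_add, Finsupp.degree_single]; omega
  · rw [← h, hw, hz]
    abel

/-! ### The cancellation step -/

section Cancel
variable {k : Type*} [Field k] {N : ℕ}

attribute [local instance] MvPolynomial.gradedAlgebra

theorem cancel_step (I S : Ideal (MvPolynomial (Fin (N + 1)) k)) (A B t : ℕ) (hA : 1 ≤ A)
    (hIsat : ∀ f, X 0 * f ∈ I → f ∈ I) (hSsat : ∀ f, X 0 * f ∈ S → f ∈ S)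
    (hIl : ∀ u : Fin (N + 1) →₀ ℕ, A ≤ u.degree → ∃ a ∈ I, X 0 ∣ a - monomial u 1)
    (hSl : ∀ u : Fin (N + 1) →₀ ℕ, B ≤ u.degree →
      ∃ b ∈ S, b.IsHomogeneous u.degree ∧ X 0 ∣ b - monomial u 1)
    (hIgen : I = Ideal.span {g | g ∈ I ∧ ∃ a ≤ A, g.IsHomogeneous a})
    (hShom : S.IsHomogeneous (homogeneousSubmodule (Fin (N + 1)) k))
    (ht : A + B ≤ t) (F : MvPolynomial (Fin (N + 1)) k) (hF : F.IsHomogeneous t)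
    (hXF : X 0 * F ∈ I * S) : F ∈ I * S := by
  classical
  set x0 : MvPolynomial (Fin (N + 1)) k := X 0 with hx0
  set U := I * S with hU
  set V := Ideal.span {x0} * U with hV
  have satI : ∀ f ∈ I, x0 ∣ f → f ∈ Ideal.span {x0} * I := by
    rintro f hf ⟨g, rfl⟩
    exact Ideal.mul_mem_mul (Ideal.mem_span_singleton_self _) (hIsat g hf)
  have satS : ∀ f ∈ S, x0 ∣ f → f ∈ Ideal.span {x0} * S := by
    rintro f hf ⟨g, rfl⟩
    exact Ideal.mul_mem_mul (Ideal.mem_span_singleton_self _) (hSsat g hf)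
  have VI : ∀ f ∈ I, x0 ∣ f → ∀ s ∈ S, f * s ∈ V := by
    intro f hf hd s hs
    rw [hV, hU, ← mul_assoc]
    exact Ideal.mul_mem_mul (satI f hf hd) hs
  have VS : ∀ f ∈ I, ∀ s ∈ S, x0 ∣ s → f * s ∈ V := by
    intro f hf s hs hd
    rw [hV, hU, mul_left_comm]
    exact Ideal.mul_mem_mul hf (satS s hs hd)
  -- choose the lifts
  have hIl' : ∀ u : Fin (N + 1) →₀ ℕ, ∃ a, A ≤ u.degree → a ∈ I ∧ x0 ∣ a - monomial u 1 := by
    intro u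
    by_cases h : A ≤ u.degree
    · obtain ⟨a, h1, h2⟩ := hIl u h
      exact ⟨a, fun _ => ⟨h1, h2⟩⟩
    · exact ⟨0, fun h' => absurd h' h⟩
  have hSl' : ∀ u : Fin (N + 1) →₀ ℕ, ∃ b, B ≤ u.degree →
      b ∈ S ∧ b.IsHomogeneous u.degree ∧ x0 ∣ b - monomial u 1 := by
    intro u
    by_cases h : B ≤ u.degree
    · obtain ⟨a, h1, h2⟩ := hSl u h
      exact ⟨a, fun _ => ⟨h1, h2⟩⟩
    · exact ⟨0, fun h' => absurd h' h⟩
  choose a ha using hIl'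
  choose b hb using hSl'
  have mon_add : ∀ (u : Fin (N + 1) →₀ ℕ) (i : Fin (N + 1)),
      (monomial (u + Finsupp.single i 1) 1 : MvPolynomial (Fin (N + 1)) k) =
        monomial u 1 * X i := by
    intro u i
    rw [X, monomial_mul, one_mul]
  -- swapping
  have swap : ∀ u v i j, u.degree + 1 = A → v.degree + 1 = t + 1 - A →
      a (u + Finsupp.single i 1) * b (v + Finsupp.single j 1) -
        a (u + Finsupp.single j 1) * b (v + Finsupp.single i 1) ∈ V := by
    intro u v i j hu hv
    have du : ∀ i, (u + Finsupp.single i 1).degree = A := fun i => by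
      rw [map_add, Finsupp.degree_single]; omega
    have dv : ∀ i, B ≤ (v + Finsupp.single i 1).degree := fun i => by
      rw [map_add, Finsupp.degree_single]; omega
    obtain ⟨hβ, -, hβd⟩ := hb v (by omega)
    obtain ⟨ai, aid⟩ := ha (u + Finsupp.single i 1) (du i).ge
    obtain ⟨aj, ajd⟩ := ha (u + Finsupp.single j 1) (du j).ge
    obtain ⟨bi, -, bid⟩ := hb (v + Finsupp.single i 1) (dv i)
    obtain ⟨bj, -, bjd⟩ := hb (v + Finsupp.single j 1) (dv j)
    have e : a (u + Finsupp.single i 1) * b (v + Finsupp.single j 1) -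
        a (u + Finsupp.single j 1) * b (v + Finsupp.single i 1) =
        a (u + Finsupp.single i 1) * (b (v + Finsupp.single j 1) - X j * b v) +
        (a (u + Finsupp.single i 1) * X j - a (u + Finsupp.single j 1) * X i) * b v -
        a (u + Finsupp.single j 1) * (b (v + Finsupp.single i 1) - X i * b v) := by ring
    rw [e]
    rw [mon_add] at aid ajd bid bjd
    have hx : ∀ i, x0 ∣ b (v + Finsupp.single i 1) - monomial v 1 * X i →
        x0 ∣ b (v + Finsupp.single i 1) - X i * b v := by
      intro i h
      have := dvd_sub h (hβd.mul_left (X i))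
      convert this using 1; ring
    refine Ideal.sub_mem _ (Ideal.add_mem _ ?_ ?_) ?_
    · exact VS _ ai _ (Ideal.sub_mem _ bj (Ideal.mul_mem_left _ _ hβ)) (hx j bjd)
    · refine VI _ (Ideal.sub_mem _ (Ideal.mul_mem_right _ _ ai) (Ideal.mul_mem_right _ _ aj)) ?_ _ hβ
      have := dvd_sub (aid.mul_left (X j)) (ajd.mul_left (X i))
      convert this using 1; ring
    · exact VS _ aj _ (Ideal.sub_mem _ bi (Ideal.mul_mem_left _ _ hβ)) (hx i bid)
  have conn : ∀ u v u' v' : Fin (N + 1) →₀ ℕ, u.degree = A → v.degree = t + 1 - A →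
      u'.degree = A → u + v = u' + v' → a u * b v - a u' * b v' ∈ V := by
    intro u v u' v' h1 h2 h3 h4
    refine swap_connect (fun x y => a x.1 * b x.2 - a y.1 * b y.2 ∈ V) (fun x => by simp) ?_ A
      (t + 1 - A) swap u v u' v' h1 h2 h3 h4
    intro x y z h1 h2
    have := Ideal.add_mem _ h1 h2
    convert this using 1; ring
  -- the chosen factorisation
  have hfac : ∀ l : Fin (N + 1) →₀ ℕ, ∃ u v : Fin (N + 1) →₀ ℕ, l.degree = t + 1 →
      u + v = l ∧ u.degree = A ∧ v.degree = t + 1 - A := by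
    intro l
    by_cases h : l.degree = t + 1
    · obtain ⟨u, v, h1, h2⟩ := exists_le_degree l A (by omega)
      refine ⟨u, v, fun _ => ⟨h1, h2, ?_⟩⟩
      rw [← h1, map_add] at h
      omega
    · exact ⟨0, 0, fun h' => absurd h' h⟩
  choose pu pv hp using hfac
  set L : Finset (Fin (N + 1) →₀ ℕ) := Finset.finsuppAntidiag Finset.univ (t + 1) with hL
  have memL : ∀ l, l ∈ L ↔ l.degree = t + 1 := by
    intro l
    rw [hL, Finset.mem_finsuppAntidiag, Finsupp.degree_eq_sum]
    simp
  let Φ : MvPolynomial (Fin (N + 1)) k → MvPolynomial (Fin (N + 1)) k := fun f =>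
    ∑ l ∈ L, C (coeff l f) * (a (pu l) * b (pv l))
  have Φadd : ∀ f g, Φ (f + g) = Φ f + Φ g := by
    intro f g
    simp only [Φ, coeff_add, C_add, add_mul, Finset.sum_add_distrib]
  have ΦC : ∀ c f, Φ (C c * f) = C c * Φ f := by
    intro c f
    simp only [Φ, coeff_C_mul, C_mul, Finset.mul_sum, mul_assoc]
  have Φx : ∀ f, Φ (x0 * f) ∈ V := by
    intro f
    refine Ideal.sum_mem _ fun l hl => ?_
    rw [memL] at hl
    rw [hx0, coeff_X_mul']
    by_cases h0 : (0 : Fin (N + 1)) ∈ l.support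
    · refine Ideal.mul_mem_left _ _ ?_
      obtain ⟨h1, h2, h3⟩ := hp l hl
      obtain ⟨ha1, ha2⟩ := ha (pu l) h2.ge
      obtain ⟨hb1, -, hb2⟩ := hb (pv l) (by omega)
      have hmon : ∀ w : Fin (N + 1) →₀ ℕ, w 0 ≠ 0 →
          x0 ∣ (monomial w 1 : MvPolynomial (Fin (N + 1)) k) := by
        intro w hw
        obtain ⟨z, hz, -⟩ := exists_single_add w 0 hw
        rw [hz, mon_add]
        exact Dvd.intro_left _ rfl
      have : pu l 0 ≠ 0 ∨ pv l 0 ≠ 0 := by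
        rw [Finsupp.mem_support_iff, ← h1, Finsupp.add_apply] at h0
        omega
      rcases this with h | h
      · exact VI _ ha1 ((dvd_sub_left (hmon _ h)).mp ha2) _ hb1
      · exact VS _ ha1 _ hb1 ((dvd_sub_left (hmon _ h)).mp hb2)
    · rw [if_neg h0, C_0, zero_mul]; exact Ideal.zero_mem _
  let Pr : MvPolynomial (Fin (N + 1)) k → Prop := fun f => f - Φ f ∈ V
  have Pradd : ∀ f g, Pr f → Pr g → Pr (f + g) := by
    intro f g hf hg
    have := Ideal.add_mem _ hf hg
    simp only [Pr, Φadd]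
    convert this using 1; ring
  have PrC : ∀ c f, Pr f → Pr (C c * f) := by
    intro c f hf
    have := Ideal.mul_mem_left V (C c) hf
    simp only [Pr, ΦC]
    convert this using 1; ring
  have PrV : ∀ f ∈ V, Pr f := by
    intro f hf
    obtain ⟨g, -, rfl⟩ := Ideal.mem_span_singleton_mul.mp hf
    exact Ideal.sub_mem _ hf (Φx g)
  have Pr0 : Pr 0 := PrV 0 (Ideal.zero_mem _)
  have Prsum : ∀ (s : Finset (Fin (N + 1) →₀ ℕ)) (f : (Fin (N + 1) →₀ ℕ) →
      MvPolynomial (Fin (N + 1)) k), (∀ i ∈ s, Pr (f i)) → Pr (∑ i ∈ s, f i) := by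
    intro s f h
    exact Finset.sum_induction f Pr Pradd Pr0 h
  have Prsub : ∀ f g, f - g ∈ V → Pr g → Pr f := by
    intro f g h hg
    have := Pradd _ _ (PrV _ h) hg
    rwa [sub_add_cancel] at this
  -- sums of lifts
  have sumlift : ∀ (f : MvPolynomial (Fin (N + 1)) k) (c : (Fin (N + 1) →₀ ℕ) →
      MvPolynomial (Fin (N + 1)) k), (∀ u ∈ f.support, x0 ∣ c u - monomial u 1) →
      x0 ∣ f - ∑ u ∈ f.support, C (coeff u f) * c u := by
    intro f c h
    conv_rhs => rw [f.as_sum]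
    have : (∑ v ∈ f.support, monomial v (coeff v f)) -
        ∑ u ∈ (∑ v ∈ f.support, monomial v (coeff v f)).support,
          C (coeff u (∑ v ∈ f.support, monomial v (coeff v f))) * c u =
        - ∑ u ∈ f.support, C (coeff u f) * (c u - monomial u 1) := by
      rw [← f.as_sum]
      nth_rewrite 1 [f.as_sum]
      rw [← Finset.sum_sub_distrib, ← Finset.sum_neg_distrib]
      refine Finset.sum_congr rfl fun u _ => ?_
      rw [mul_sub, C_mul_monomial, mul_one]; ring
    rw [this, dvd_neg]
    exact Finset.dvd_sum fun u hu => (h u hu).mul_left _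
  have degsupp : ∀ (f : MvPolynomial (Fin (N + 1)) k) c, f.IsHomogeneous c → ∀ u ∈ f.support,
      u.degree = c := by
    intro f c hf u hu
    by_contra h
    exact (mem_support_iff.mp hu) (hf.coeff_eq_zero h)
  -- top degree generators
  have main1 : ∀ g ∈ I, g.IsHomogeneous A → ∀ s ∈ S, s.IsHomogeneous (t + 1 - A) →
      Pr (g * s) := by
    intro g hg hgA s hs hsB
    have e1 := sumlift g a (fun u hu => (ha u (degsupp g A hgA u hu).ge).2)
    have e2 := sumlift s b (fun u hu => (hb u (by rw [degsupp s _ hsB u hu]; omega)).2.2)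
    set g' := ∑ u ∈ g.support, C (coeff u g) * a u with hg'
    set s' := ∑ u ∈ s.support, C (coeff u s) * b u with hs'
    have hg'I : g' ∈ I := Ideal.sum_mem _ fun u hu =>
      Ideal.mul_mem_left _ _ (ha u (degsupp g A hgA u hu).ge).1
    have hs'S : s' ∈ S := Ideal.sum_mem _ fun u hu =>
      Ideal.mul_mem_left _ _ (hb u (by rw [degsupp s _ hsB u hu]; omega)).1
    refine Prsub _ (g' * s') ?_ ?_
    · have : g * s - g' * s' = (g - g') * s + g' * (s - s') := by ring
      rw [this]
      exact Ideal.add_mem _ (VI _ (Ideal.sub_mem _ hg hg'I) e1 _ hs)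
        (VS _ hg'I _ (Ideal.sub_mem _ hs hs'S) e2)
    · rw [hg', hs', Finset.sum_mul_sum]
      refine Prsum _ _ fun u hu => Prsum _ _ fun v hv => ?_
      have du := degsupp g A hgA u hu
      have dv := degsupp s _ hsB v hv
      have : C (coeff u g) * a u * (C (coeff v s) * b v) =
          C (coeff u g) * (C (coeff v s) * (a u * b v)) := by ring
      rw [this]
      refine PrC _ _ (PrC _ _ ?_)
      obtain ⟨ha1, ha2⟩ := ha u du.ge
      obtain ⟨hb1, -, hb2⟩ := hb v (by omega)
      have hd : x0 ∣ a u * b v - monomial (u + v) 1 := by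
        have := dvd_add (ha2.mul_right (b v)) (hb2.mul_left (monomial u 1))
        convert this using 1
        rw [sub_mul, mul_sub, monomial_mul, one_mul]; ring
      obtain ⟨h, hh⟩ := hd
      have e3 : a u * b v = monomial (u + v) 1 + x0 * h := by rw [← hh]; ring
      have hdeg : (u + v).degree = t + 1 := by rw [map_add]; omega
      have e4 : Φ (monomial (u + v) 1) = a (pu (u + v)) * b (pv (u + v)) := by
        simp only [Φ, coeff_monomial]
        rw [Finset.sum_eq_single_of_mem (u + v) ((memL _).mpr hdeg)]
        · simp
        · intro l _ hl
          rw [if_neg (Ne.symm hl)]; simp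
      have e5 : Φ (a u * b v) = a (pu (u + v)) * b (pv (u + v)) + Φ (x0 * h) := by
        rw [e3, Φadd, e4]
      simp only [Pr]
      rw [e5, ← sub_sub]
      obtain ⟨h1, h2, h3⟩ := hp (u + v) hdeg
      exact Ideal.sub_mem _ (conn _ _ _ _ du dv h2 h1.symm) (Φx h)
  have main2 : ∀ c, ∀ g ∈ I, ∀ r, r + c = A → g.IsHomogeneous r → ∀ s ∈ S,
      s.IsHomogeneous (t + 1 - r) → Pr (g * s) := by
    intro c
    induction c with
    | zero =>
      intro g hg r hr hgr s hs hsr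
      rw [add_zero] at hr
      subst hr
      exact main1 g hg hgr s hs hsr
    | succ c ih =>
      intro g hg r hr hgr s hs hsr
      -- peel off one variable
      have hpeel : ∀ v : Fin (N + 1) →₀ ℕ, ∃ w i, v ∈ s.support →
          v = w + Finsupp.single i 1 ∧ v.degree = w.degree + 1 := by
        intro v
        by_cases hv : v ∈ s.support
        · have hd := degsupp s _ hsr v hv
          have hv0 : v ≠ 0 := by
            rintro rfl
            simp at hd
            omega
          obtain ⟨i, hi⟩ := Finsupp.support_nonempty_iff.mpr hv0
          obtain ⟨w, hw⟩ := exists_single_add v i (Finsupp.mem_support_iff.mp hi)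
          exact ⟨w, i, fun _ => hw⟩
        · exact ⟨0, 0, fun h => absurd h hv⟩
      choose w i hwi using hpeel
      have hw : ∀ v ∈ s.support, (w v).degree = t - r := by
        intro v hv
        have := degsupp s _ hsr v hv
        have := (hwi v hv).2
        omega
      have hbw : ∀ v ∈ s.support, b (w v) ∈ S ∧ (b (w v)).IsHomogeneous (w v).degree ∧
          x0 ∣ b (w v) - monomial (w v) 1 := fun v hv => hb _ (by rw [hw v hv]; omega)
      have e2 := sumlift s (fun v => X (i v) * b (w v)) (by
        intro v hv
        have h1 := (hbw v hv).2.2.mul_left (X (i v))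
        have h2 : (monomial v 1 : MvPolynomial (Fin (N + 1)) k) = monomial (w v) 1 * X (i v) := by
          rw [← mon_add, ← (hwi v hv).1]
        rw [h2]
        convert h1 using 1; ring)
      set s' := ∑ v ∈ s.support, C (coeff v s) * (X (i v) * b (w v)) with hs'
      have hs'S : s' ∈ S := Ideal.sum_mem _ fun v hv =>
        Ideal.mul_mem_left _ _ (Ideal.mul_mem_left _ _ (hbw v hv).1)
      refine Prsub _ (g * s') ?_ ?_
      · rw [← mul_sub]
        exact VS _ hg _ (Ideal.sub_mem _ hs hs'S) e2
      · rw [hs', Finset.mul_sum]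
        refine Prsum _ _ fun v hv => ?_
        have : g * (C (coeff v s) * (X (i v) * b (w v))) =
            C (coeff v s) * ((X (i v) * g) * b (w v)) := by ring
        rw [this]
        refine PrC _ _ (ih _ (Ideal.mul_mem_left _ _ hg) (1 + r) (by omega)
          ((isHomogeneous_X _ _).mul hgr) _ (hbw v hv).1 ?_)
        have := (hbw v hv).2.1
        rw [hw v hv] at this
        have e : t + 1 - (1 + r) = t - r := by omega
        rwa [e]
  -- graded generators of `U`
  have hUspan : U = Ideal.span {y | ∃ g s, g ∈ I ∧ (∃ r ≤ A, g.IsHomogeneous r) ∧ s ∈ S ∧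
      (∃ c, s.IsHomogeneous c) ∧ y = g * s} := by
    have hS : S = Ideal.span {s | s ∈ S ∧ ∃ c, s.IsHomogeneous c} := by
      apply le_antisymm
      · exact le_of_homog hShom fun F hF c hc => Ideal.subset_span ⟨hF, c, hc⟩
      · exact Ideal.span_le.mpr fun x hx => hx.1
    refine (congrArg₂ (fun x y => x * y) hIgen hS).trans
      ((Ideal.span_mul_span' _ _).trans ?_)
    congr 1
    ext y
    constructor
    · rintro ⟨g, ⟨hg1, hg2⟩, s, ⟨hs1, hs2⟩, rfl⟩
      exact ⟨g, s, hg1, hg2, hs1, hs2, rfl⟩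
    · rintro ⟨g, s, hg1, hg2, hs1, hs2, rfl⟩
      exact ⟨g, ⟨hg1, hg2⟩, s, ⟨hs1, hs2⟩, rfl⟩
  have final : Pr (x0 * F) := by
    have hxF : (x0 * F).IsHomogeneous (t + 1) := by
      have := (isHomogeneous_X k (0 : Fin (N + 1))).mul hF
      have e : 1 + t = t + 1 := by omega
      rwa [e] at this
    rw [hUspan] at hXF
    refine graded_span_induction Pr ?_ Pr0 Pradd ?_ hXF hxF
    · rintro y ⟨g, s, -, ⟨r, -, hr⟩, -, ⟨c, hc⟩, rfl⟩
      exact ⟨_, hr.mul hc⟩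
    · rintro y ⟨g, s, hg, ⟨r, hr, hgr⟩, hs, ⟨c, hsc⟩, rfl⟩ q hq hqt h hh
      by_cases h0 : g * s = 0
      · rw [h0, mul_zero]; exact Pr0
      have hqq : q = r + c := hq.inj_right (hgr.mul hsc) h0
      have : h * (g * s) = g * (h * s) := by ring
      rw [this]
      refine main2 (A - r) g hg r (by omega) hgr _ (Ideal.mul_mem_left _ _ hs) ?_
      have := hh.mul hsc
      have e : t + 1 - q + c = t + 1 - r := by omega
      rwa [e] at this
  have hfin : x0 * F ∈ V := by
    have := Ideal.add_mem _ final (Φx F)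
    rwa [sub_add_cancel] at this
  obtain ⟨G, hG, hGF⟩ := Ideal.mem_span_singleton_mul.mp hfin
  have : G = F := mul_left_cancel₀ (X_ne_zero 0) hGF
  rwa [← this]

end Cancel

/-! ### Regularity -/

section Regularity

attribute [local instance] MvPolynomial.gradedAlgebra

lemma homog_mem_maxIdeal_pow {k : Type*} [Field k] {N : ℕ} {F : MvPolynomial (Fin (N + 1)) k}
    {t q : ℕ} (hF : F.IsHomogeneous t) (h : q ≤ t) : F ∈ maxIdeal k N ^ q := by
  have e : maxIdeal k N =
      Ideal.span (X '' ((Finset.univ : Finset (Fin (N + 1))) : Set (Fin (N + 1)))) := by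
    rw [maxIdeal, Finset.coe_univ, Set.image_univ]
  rw [e, mem_span_X_pow]
  intro b hb
  have hd : b.degree = t := by
    by_contra h
    exact (mem_support_iff.mp hb) (hF.coeff_eq_zero h)
  rw [Finsupp.degree_eq_sum] at hd
  omega

/-- The translation moving `(1, 0, …, 0)` to `p`. -/
noncomputable def transHom {k : Type*} [Field k] {N : ℕ} (p : Fin (N + 1) → k) :
    MvPolynomial (Fin (N + 1)) k →ₐ[k] MvPolynomial (Fin (N + 1)) k :=
  aeval fun i => if i = 0 then X 0 else X i + C (p i) * X 0

lemma transHom_comp {k : Type*} [Field k] {N : ℕ} (p q : Fin (N + 1) → k) (h : ∀ i, p i + q i = 0) :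
    (transHom p).comp (transHom q) = AlgHom.id k _ := by
  ext i : 1
  by_cases hi : i = 0
  · subst hi; simp [transHom]
  · have : (C (p i) + C (q i) : MvPolynomial (Fin (N + 1)) k) = 0 := by
      rw [← C_add, h, C_0]
    simp only [transHom, AlgHom.comp_apply, aeval_X, hi, if_false, map_add, map_mul, aeval_C,
      if_true, AlgHom.id_apply, algebraMap_eq]
    linear_combination X 0 * this

lemma transHom_homog {k : Type*} [Field k] {N : ℕ} (p : Fin (N + 1) → k) (i : Fin (N + 1)) :
    (transHom p (X i)).IsHomogeneous 1 := by
  rw [transHom, aeval_X]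
  split_ifs
  · exact isHomogeneous_X _ _
  · exact (isHomogeneous_X _ _).add (isHomogeneous_C_mul_X _ _)

lemma pointIdeal_sat {k : Type*} [Field k] {N : ℕ} (p : Fin (N + 1) → k) (hp : p 0 = 1) (r : ℕ)
    (F : MvPolynomial (Fin (N + 1)) k) (h : X 0 * F ∈ pointIdeal p ^ r) :
    F ∈ pointIdeal p ^ r := by
  classical
  let τ : MvPolynomial (Fin (N + 1)) k ≃ₐ[k] MvPolynomial (Fin (N + 1)) k :=
    AlgEquiv.ofAlgHom (transHom p) (transHom (-p)) (transHom_comp _ _ (by simp))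
      (transHom_comp _ _ (by simp))
  have key := mem_pointIdeal_pow_iff τ (fun i => transHom_homog p i)
    (fun i => transHom_homog (-p) i) p 0 (by
      intro i
      change eval _ (transHom p (X i)) = _
      rw [transHom, aeval_X]
      split_ifs with hi
      · subst hi; simp [hp]
      · simp [hi]) r
  rw [key] at h ⊢
  intro b hb
  have e : τ (X 0 * F) = X 0 * τ F := by
    rw [map_mul]
    congr 1
    change transHom p (X 0) = _
    simp [transHom]
  have := h (Finsupp.single 0 1 + b) (by
    rw [e, mem_support_iff, coeff_X_mul]
    exact mem_support_iff.mp hb)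
  refine this.trans (le_of_eq (Finset.sum_congr rfl fun i hi => ?_))
  have : i ≠ 0 := by simpa using hi
  simp [Finsupp.single_eq_of_ne this]

lemma eval_pointIdeal {k σ : Type*} [Field k] {p : σ → k}
    {F : MvPolynomial σ k} (h : F ∈ pointIdeal p) : eval p F = 0 := by
  have : pointIdeal p ≤ RingHom.ker (eval p) := by
    rw [pointIdeal, Ideal.span_le]
    rintro f ⟨-, hf⟩
    exact hf
  exact this h

variable {k : Type*} [Field k] {N n : ℕ} (p : Fin n → (Fin (N + 1) → k))

lemma mem_fat {m : Fin n → ℕ} {F : MvPolynomial (Fin (N + 1)) k} :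
    F ∈ fatIdeal p m ↔ ∀ j, F ∈ pointIdeal (p j) ^ m j := by
  rw [fatIdeal, Ideal.mem_iInf]

lemma mem_fat_one {F : MvPolynomial (Fin (N + 1)) k} {t : ℕ} (hF : F.IsHomogeneous t) :
    F ∈ fatIdeal p (fun _ => 1) ↔ ∀ j, eval (p j) F = 0 := by
  rw [mem_fat]
  refine forall_congr' fun j => ?_
  rw [pow_one]
  exact ⟨eval_pointIdeal, fun h => Ideal.subset_span ⟨⟨t, hF⟩, h⟩⟩

lemma fat_mul_le (a b : ℕ) : fatIdeal p (fun _ => a) * fatIdeal p (fun _ => b) ≤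
    fatIdeal p (fun _ => a + b) := by
  rw [Ideal.mul_le]
  intro f hf g hg
  rw [mem_fat] at *
  intro j
  rw [pow_add]
  exact Ideal.mul_mem_mul (hf j) (hg j)

lemma fat_one_pow_le (r : ℕ) : fatIdeal p (fun _ => 1) ^ r ≤ fatIdeal p (fun _ => r) := by
  induction r with
  | zero =>
    intro f _
    rw [mem_fat]; simp
  | succ r ih =>
    rw [pow_succ]
    exact (Ideal.mul_mono_left ih).trans (fat_mul_le p r 1)

lemma fat_anti {a b : ℕ} (h : a ≤ b) : fatIdeal p (fun _ => b) ≤ fatIdeal p (fun _ => a) := by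
  intro f hf
  rw [mem_fat] at *
  exact fun j => Ideal.pow_le_pow_right h (hf j)

lemma fat_sat (hp : ∀ j, p j 0 = 1) (r : ℕ) (F : MvPolynomial (Fin (N + 1)) k)
    (h : X 0 * F ∈ fatIdeal p (fun _ => r)) : F ∈ fatIdeal p (fun _ => r) := by
  rw [mem_fat] at *
  exact fun j => pointIdeal_sat (p j) (hp j) r F (h j)

/-- Subtract the interpolating form. -/
noncomputable def red (d : ℕ) (e : Fin n → MvPolynomial (Fin (N + 1)) k) (s : ℕ)
    (F : MvPolynomial (Fin (N + 1)) k) : MvPolynomial (Fin (N + 1)) k :=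
  F - ∑ j, C (eval (p j) F) * (X 0 ^ (s - d) * e j)

section
variable {p}

lemma red_homog {d : ℕ} {e : Fin n → MvPolynomial (Fin (N + 1)) k}
    (he : ∀ j, (e j).IsHomogeneous d) {s : ℕ} (hs : d ≤ s) {F : MvPolynomial (Fin (N + 1)) k} (hF : F.IsHomogeneous s) :
    (red p d e s F).IsHomogeneous s := by
  refine hF.sub (IsHomogeneous.sum _ _ _ fun j _ => ?_)
  have := ((isHomogeneous_X_pow (R := k) (0 : Fin (N + 1)) (s - d)).mul (he j)).C_mul (eval (p j) F)
  rwa [Nat.sub_add_cancel hs] at this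

lemma red_mem {d : ℕ} {e : Fin n → MvPolynomial (Fin (N + 1)) k}
    (hp : ∀ j, p j 0 = 1)
    (he : ∀ j, (e j).IsHomogeneous d)
    (hd : ∀ i j, eval (p i) (e j) = if i = j then 1 else 0) {s : ℕ} (hs : d ≤ s) {F : MvPolynomial (Fin (N + 1)) k} (hF : F.IsHomogeneous s) :
    red p d e s F ∈ fatIdeal p (fun _ => 1) := by
  rw [mem_fat_one p (red_homog he hs hF)]
  intro i
  simp [red, map_sum, hp, hd]

lemma fat_one_gen {d : ℕ} {e : Fin n → MvPolynomial (Fin (N + 1)) k}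
    (hp : ∀ j, p j 0 = 1)
    (he : ∀ j, (e j).IsHomogeneous d)
    (hd : ∀ i j, eval (p i) (e j) = if i = j then 1 else 0) : fatIdeal p (fun _ => 1) =
    Ideal.span {g | g ∈ fatIdeal p (fun _ => 1) ∧ ∃ a ≤ d + 1, g.IsHomogeneous a} := by
  set J := Ideal.span {g | g ∈ fatIdeal p (fun _ => 1) ∧ ∃ a ≤ d + 1, g.IsHomogeneous a} with hJ
  have key : ∀ s, d ≤ s → ∀ F : MvPolynomial (Fin (N + 1)) k, F.IsHomogeneous s →
      red p d e s F ∈ J := by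
    intro s hs
    induction s, hs using Nat.le_induction with
    | base =>
      intro F hF
      exact Ideal.subset_span ⟨red_mem hp he hd le_rfl hF, d, by omega,
        red_homog he le_rfl hF⟩
    | succ s hs ih =>
      intro F hF
      have hFM : F ∈ Ideal.span (Set.range X) := by
        have := homog_mem_maxIdeal_pow (q := 1) hF (by omega)
        rwa [pow_one, maxIdeal] at this
      refine graded_span_induction (fun F => red p d e (s + 1) F ∈ J) ?_ ?_ ?_ ?_ hFM hF
      · rintro _ ⟨c, rfl⟩
        exact ⟨1, isHomogeneous_X _ _⟩
      · simp [red]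
      · intro x y hx hy
        have : red p d e (s + 1) (x + y) = red p d e (s + 1) x + red p d e (s + 1) y := by
          simp only [red, map_add, add_mul, Finset.sum_add_distrib]; ring
        rw [this]
        exact J.add_mem hx hy
      · rintro _ ⟨c, rfl⟩ a ha - h hh
        have ha1 : a = 1 := ha.inj_right (isHomogeneous_X k c) (X_ne_zero c)
        subst ha1
        rw [Nat.add_sub_cancel] at hh
        have e1 : red p d e (s + 1) (h * X c) = X c * red p d e s h +
            ∑ j, C (eval (p j) h) * X 0 ^ (s - d) * (X c * e j - C (p j c) * (X 0 * e j)) := by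
          have : s + 1 - d = s - d + 1 := by omega
          simp only [red, this, map_mul, eval_X, mul_sub, Finset.sum_sub_distrib, pow_succ,
            Finset.mul_sum]
          have h1 : ∀ j, X c * (C (eval (p j) h) * (X 0 ^ (s - d) * e j)) =
            C (eval (p j) h) * X 0 ^ (s - d) * (X c * e j) := fun j => by ring
          simp only [h1]
          have h2 : ∀ j, C (eval (p j) h) * C (p j c) * (X 0 ^ (s - d) * X 0 * e j) =
            C (eval (p j) h) * X 0 ^ (s - d) * (C (p j c) * (X 0 * e j)) := fun j => by ring
          simp only [h2]
          ring
        rw [e1]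
        refine J.add_mem (J.mul_mem_left _ (ih h hh)) (J.sum_mem fun j _ => J.mul_mem_left _ ?_)
        have hom : (X c * e j - C (p j c) * (X 0 * e j)).IsHomogeneous (1 + d) :=
          ((isHomogeneous_X _ _).mul (he j)).sub (((isHomogeneous_X _ _).mul (he j)).C_mul _)
        refine Ideal.subset_span ⟨?_, 1 + d, by omega, hom⟩
        rw [mem_fat_one p hom]
        intro i
        by_cases hij : i = j
        · subst hij; simp [hd, hp]
        · simp [hd, hij]
  apply le_antisymm
  · refine le_of_homog (fatIdeal_homog _ _) fun F hF t ht => ?_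
    by_cases h : t ≤ d
    · exact Ideal.subset_span ⟨hF, t, by omega, ht⟩
    · have h1 := key t (by omega) F ht
      have h2 : red p d e t F = F := by
        rw [mem_fat_one p ht] at hF
        simp [red, hF]
      rwa [h2] at h1
  · exact Ideal.span_le.mpr fun x hx => hx.1

lemma lift_one {d : ℕ} {e : Fin n → MvPolynomial (Fin (N + 1)) k}
    (hp : ∀ j, p j 0 = 1)
    (he : ∀ j, (e j).IsHomogeneous d)
    (hd : ∀ i j, eval (p i) (e j) = if i = j then 1 else 0) (u : Fin (N + 1) →₀ ℕ) (hu : d + 1 ≤ u.degree) :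
    ∃ a ∈ fatIdeal p (fun _ => 1), a.IsHomogeneous u.degree ∧ X 0 ∣ a - monomial u 1 := by
  have hm : (monomial u (1 : k)).IsHomogeneous u.degree := isHomogeneous_monomial _ rfl
  refine ⟨red p d e u.degree (monomial u 1), red_mem hp he hd (by omega) hm,
    red_homog he (by omega) hm, ?_⟩
  have : u.degree - d = (u.degree - d - 1) + 1 := by omega
  rw [red, sub_sub_cancel_left, dvd_neg]
  refine Finset.dvd_sum fun j _ => ?_
  rw [this, pow_succ]
  exact Dvd.intro_left (C (eval (p j) (monomial u 1)) * X 0 ^ (u.degree - d - 1) * e j) (by ring)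

lemma lift_fat {d : ℕ} {e : Fin n → MvPolynomial (Fin (N + 1)) k}
    (hp : ∀ j, p j 0 = 1)
    (he : ∀ j, (e j).IsHomogeneous d)
    (hd : ∀ i j, eval (p i) (e j) = if i = j then 1 else 0) (q : ℕ) : ∀ (u : Fin (N + 1) →₀ ℕ) (_ : q * (d + 1) ≤ u.degree),
    ∃ a ∈ fatIdeal p (fun _ => q), a.IsHomogeneous u.degree ∧ X 0 ∣ a - monomial u 1 := by
  induction q with
  | zero =>
    intro u _
    refine ⟨monomial u 1, ?_, isHomogeneous_monomial _ rfl, by simp⟩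
    rw [mem_fat]; simp
  | succ q ih =>
    intro u hu
    obtain ⟨u1, u2, h1, h2⟩ := exists_le_degree u (d + 1) (by
      refine le_trans ?_ hu
      exact Nat.le_mul_of_pos_left _ (by omega))
    have hdeg : u.degree = u1.degree + u2.degree := by rw [← h1, map_add]
    obtain ⟨a, ha1, ha2, ha3⟩ := lift_one hp he hd u1 h2.ge
    obtain ⟨b, hb1, hb2, hb3⟩ := ih u2 (by rw [Nat.add_mul] at hu; omega)
    refine ⟨b * a, fat_mul_le p q 1 (Ideal.mul_mem_mul hb1 ha1), ?_, ?_⟩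
    · rw [hdeg, Nat.add_comm u1.degree u2.degree]; exact hb2.mul ha2
    · have : b * a - monomial u 1 = (b - monomial u2 1) * a + monomial u2 1 * (a - monomial u1 1) := by
        rw [← h1, add_comm u1 u2]
        have : (monomial (u2 + u1) 1 : MvPolynomial (Fin (N + 1)) k) = monomial u2 1 * monomial u1 1 := by
          rw [monomial_mul, one_mul]
        rw [this]; ring
      rw [this]
      exact dvd_add (Dvd.dvd.mul_right hb3 _) (Dvd.dvd.mul_left ha3 _)

lemma stepC {d : ℕ} {e : Fin n → MvPolynomial (Fin (N + 1)) k}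
    (hp : ∀ j, p j 0 = 1)
    (he : ∀ j, (e j).IsHomogeneous d)
    (hd : ∀ i j, eval (p i) (e j) = if i = j then 1 else 0) (r : ℕ) {F : MvPolynomial (Fin (N + 1)) k} (hF : F ∈ fatIdeal p (fun _ => r + 1)) :
    X 0 ^ (d * (r + 1)) * F ∈ fatIdeal p (fun _ => 1) * fatIdeal p (fun _ => r) := by
  have hv : X 0 ^ (d * (r + 1)) - ∑ i, e i ^ (r + 1) ∈ fatIdeal p (fun _ => 1) := by
    have hom : (X 0 ^ (d * (r + 1)) - ∑ i, e i ^ (r + 1)).IsHomogeneous (d * (r + 1)) :=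
      (isHomogeneous_X_pow _ _).sub (IsHomogeneous.sum _ _ _ fun j _ => (he j).pow _)
    rw [mem_fat_one p hom]
    intro j
    simp [map_sum, hp, hd, ite_pow]
  have e1 : X 0 ^ (d * (r + 1)) * F = (X 0 ^ (d * (r + 1)) - ∑ i, e i ^ (r + 1)) * F +
      ∑ i, e i ^ (r + 1) * F := by
    rw [← Finset.sum_mul]; ring
  rw [e1]
  refine Ideal.add_mem _ (Ideal.mul_mem_mul hv (fat_anti p (Nat.le_succ r) hF))
    (Ideal.sum_mem _ fun i _ => ?_)
  have h1 : Ideal.span {e i} * pointIdeal (p i) ≤ fatIdeal p (fun _ => 1) := by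
    rw [pointIdeal, Ideal.span_mul_span', Ideal.span_le]
    rintro _ ⟨_, rfl, g, ⟨⟨a, ha⟩, hg⟩, rfl⟩
    change e i * g ∈ fatIdeal p (fun _ => 1)
    rw [mem_fat_one p ((he i).mul ha)]
    intro j
    rw [map_mul, hd]
    by_cases hij : j = i
    · subst hij; rw [hg, mul_zero]
    · rw [if_neg hij, zero_mul]
  have h2 : Ideal.span {e i} ^ (r + 1) * pointIdeal (p i) ^ (r + 1) ≤
      fatIdeal p (fun _ => 1) * fatIdeal p (fun _ => r) := by
    rw [← mul_pow, pow_succ']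
    exact Ideal.mul_mono h1 ((Ideal.pow_right_mono h1 r).trans (fat_one_pow_le p r))
  exact h2 (Ideal.mul_mem_mul (Ideal.pow_mem_pow (Ideal.mem_span_singleton_self _) _)
    ((mem_fat p).mp hF i))

lemma fat_succ {d : ℕ} {e : Fin n → MvPolynomial (Fin (N + 1)) k}
    (hp : ∀ j, p j 0 = 1)
    (he : ∀ j, (e j).IsHomogeneous d)
    (hd : ∀ i j, eval (p i) (e j) = if i = j then 1 else 0) (r : ℕ) {F : MvPolynomial (Fin (N + 1)) k} (hF : F ∈ fatIdeal p (fun _ => r + 1))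
    {t : ℕ} (ht : (r + 1) * (d + 1) ≤ t) (hFt : F.IsHomogeneous t) :
    F ∈ fatIdeal p (fun _ => 1) * fatIdeal p (fun _ => r) := by
  have key : ∀ m, ∀ t, (r + 1) * (d + 1) ≤ t → ∀ F : MvPolynomial (Fin (N + 1)) k,
      F.IsHomogeneous t → X 0 ^ m * F ∈ fatIdeal p (fun _ => 1) * fatIdeal p (fun _ => r) →
      F ∈ fatIdeal p (fun _ => 1) * fatIdeal p (fun _ => r) := by
    intro m
    induction m with
    | zero => intro t _ F _ h; simpa using h
    | succ m ih =>
      intro t ht F hF h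
      refine cancel_step _ _ (d + 1) (r * (d + 1)) t (by omega) (fat_sat p hp 1) (fat_sat p hp r)
        ?_ (lift_fat hp he hd r) (fat_one_gen hp he hd) (fatIdeal_homog _ _) ?_ F hF ?_
      · intro u hu
        obtain ⟨a, h1, -, h2⟩ := lift_one hp he hd u hu
        exact ⟨a, h1, h2⟩
      · rw [Nat.add_mul] at ht; omega
      · refine ih (1 + t) (by omega) _ ((isHomogeneous_X _ _).mul hF) ?_
        rwa [← mul_assoc, ← pow_succ]
  exact key _ t ht F hFt (stepC hp he hd r hF)

/-- The regularity theorem. -/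
lemma regularity {d : ℕ} {e : Fin n → MvPolynomial (Fin (N + 1)) k}
    (hp : ∀ j, p j 0 = 1)
    (he : ∀ j, (e j).IsHomogeneous d)
    (hd : ∀ i j, eval (p i) (e j) = if i = j then 1 else 0) (r : ℕ) : ∀ (q t : ℕ) (F : MvPolynomial (Fin (N + 1)) k),
    F ∈ fatIdeal p (fun _ => r) → F.IsHomogeneous t → r * (d + 1) + q ≤ t →
    F ∈ maxIdeal k N ^ q * fatIdeal p (fun _ => 1) ^ r := by
  induction r with
  | zero =>
    intro q t F _ hF ht
    rw [pow_zero, mul_one]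
    exact homog_mem_maxIdeal_pow hF (by omega)
  | succ r ih =>
    intro q t F hF hFt ht
    have h1 := fat_succ hp he hd r hF (by omega) hFt
    have hS : fatIdeal p (fun _ => r) =
        Ideal.span {s | s ∈ fatIdeal p (fun _ => r) ∧ ∃ c, s.IsHomogeneous c} := by
      apply le_antisymm
      · exact le_of_homog (fatIdeal_homog _ _) fun F hF c hc => Ideal.subset_span ⟨hF, c, hc⟩
      · exact Ideal.span_le.mpr fun x hx => hx.1
    have h2 := (congrArg₂ (fun x y => x * y) (fat_one_gen hp he hd) hS).trans
      (Ideal.span_mul_span' _ _)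
    rw [h2] at h1
    refine graded_span_induction
      (fun F => F ∈ maxIdeal k N ^ q * fatIdeal p (fun _ => 1) ^ (r + 1)) ?_
      (Ideal.zero_mem _) (fun x y => Ideal.add_mem _) ?_ h1 hFt
    · rintro _ ⟨g, ⟨-, a, -, ha⟩, s, ⟨-, c, hc⟩, rfl⟩
      exact ⟨_, ha.mul hc⟩
    · rintro _ ⟨g, ⟨hg, a, had, ha⟩, s, ⟨hs, c, hc⟩, rfl⟩ a' ha' hat h hh
      change h * (g * s) ∈ _
      by_cases h0 : g * s = 0
      · rw [h0, mul_zero]; exact Ideal.zero_mem _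
      have : a' = a + c := ha'.inj_right (ha.mul hc) h0
      have e1 : h * (g * s) = (h * s) * g := by ring
      rw [e1, pow_succ, ← mul_assoc]
      refine Ideal.mul_mem_mul (ih q (t - a' + c) _ (Ideal.mul_mem_left _ _ hs) (hh.mul hc) ?_) hg
      rw [Nat.add_mul] at ht
      omega
end

end Regularity

/-! ### Separators -/

lemma exists_exponents (n d : ℕ) (h : n ≤ (d + 3).choose 3) :
    ∃ a : Fin n → (Fin 4 →₀ ℕ), Function.Injective a ∧ ∀ j, (a j).degree = d := by
  classical
  have hc : ((Finset.univ : Finset (Fin 4)).finsuppAntidiag d).card = (d + 3).choose 3 := by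
    rw [Finset.card_finsuppAntidiag_nat_eq_choose, Finset.card_univ, Fintype.card_fin]
    have : 4 + d - 1 = d + 3 := by omega
    rw [this]
    exact Nat.choose_symm_add
  obtain ⟨s, hs, hsc⟩ := Finset.exists_subset_card_eq (hc ▸ h)
  refine ⟨fun j => (s.equivFinOfCardEq hsc).symm j, ?_, fun j => ?_⟩
  · intro i j hij
    exact (s.equivFinOfCardEq hsc).symm.injective (Subtype.ext hij)
  · have := hs ((s.equivFinOfCardEq hsc).symm j).2
    rw [Finset.mem_finsuppAntidiag] at this
    rw [Finsupp.degree_eq_sum]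
    exact this.1

lemma gen_sep (k : Type*) [Field k] [Infinite k] (n d : ℕ) (h : n ≤ (d + 3).choose 3) :
    Gen k 3 n (fun p => ∃ e : Fin n → MvPolynomial (Fin (3 + 1)) k, (∀ j, (e j).IsHomogeneous d) ∧
      ∀ i j, eval (p i) (e j) = if i = j then 1 else 0) := by
  classical
  obtain ⟨a, ha, had⟩ := exists_exponents n d h
  let Mx : Matrix (Fin n) (Fin n) (MvPolynomial (Fin n × Fin (3 + 1)) k) :=
    Matrix.of fun i j => rename (fun l => (i, l)) (monomial (a j) 1)
  have hev : ∀ p : Fin n → Fin (3 + 1) → k, eval (fun q => p q.1 q.2) Mx.det =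
      (Matrix.of fun i j => eval (p i) (monomial (a j) 1) : Matrix (Fin n) (Fin n) k).det := by
    intro p
    rw [RingHom.map_det]
    congr 1
    ext i j
    simp only [Mx, RingHom.mapMatrix_apply, Matrix.map_apply, Matrix.of_apply, eval_rename]
    rfl
  refine ⟨Mx.det, ?_, fun p hp => ?_⟩
  · intro h0
    obtain ⟨v, hv⟩ := exists_eval_ne_zero (k := k) (∏ i, ∏ j ∈ Finset.univ.erase i,
      (monomial (a i) 1 - monomial (a j) 1)) (by
        refine Finset.prod_ne_zero_iff.mpr fun i _ => Finset.prod_ne_zero_iff.mpr fun j hj => ?_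
        rw [sub_ne_zero]
        intro e
        have := monomial_left_injective (one_ne_zero' k) e
        have h2 := ha this
        simp [h2] at hj)
    let w : Fin n → k := fun j => eval v (monomial (a j) 1)
    have hw : Function.Injective w := by
      intro i j hij
      by_contra hne
      apply hv
      rw [map_prod]
      refine Finset.prod_eq_zero (Finset.mem_univ i) ?_
      rw [map_prod]
      refine Finset.prod_eq_zero (i := j) (by simp [Ne.symm hne]) ?_
      rw [map_sub, sub_eq_zero]
      exact hij
    have h1 := hev (fun i l => v l ^ (i : ℕ))
    rw [h0, map_zero] at h1
    have h2 : (Matrix.of fun i j => eval (fun l => v l ^ (i : ℕ)) (monomial (a j) 1) :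
        Matrix (Fin n) (Fin n) k) = (Matrix.vandermonde w).transpose := by
      ext i j
      simp only [Matrix.of_apply, Matrix.transpose_apply, Matrix.vandermonde_apply, w,
        eval_monomial, one_mul, Finsupp.prod]
      rw [← Finset.prod_pow]
      refine Finset.prod_congr rfl fun l _ => ?_
      rw [← pow_mul, ← pow_mul, Nat.mul_comm]
    rw [h2, Matrix.det_transpose] at h1
    exact Matrix.det_vandermonde_ne_zero_iff.mpr hw h1.symm
  · rw [hev] at hp
    set M : Matrix (Fin n) (Fin n) k := Matrix.of fun i j => eval (p i) (monomial (a j) 1) with hM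
    refine ⟨fun j => ∑ l, C (M⁻¹ l j) * monomial (a l) 1, fun j => ?_, fun i j => ?_⟩
    · refine IsHomogeneous.sum _ _ _ fun l _ => (isHomogeneous_monomial _ (had l)).C_mul _
    · have h1 : M * M⁻¹ = 1 := Matrix.mul_nonsing_inv M (isUnit_iff_ne_zero.mpr hp)
      have h2 := congrFun (congrFun h1 i) j
      rw [Matrix.mul_apply, Matrix.one_apply] at h2
      rw [← h2, map_sum]
      refine Finset.sum_congr rfl fun l _ => ?_
      rw [map_mul, eval_C, mul_comm]
      rfl

/-! ### Lower bounds for degrees -/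

/-- Dehomogenization. -/
noncomputable def dehom {k : Type*} [Field k] {N : ℕ} :
    MvPolynomial (Fin (N + 1)) k →ₐ[k] MvPolynomial (Fin N) k :=
  aeval (Fin.cons 1 X : Fin (N + 1) → MvPolynomial (Fin N) k)

lemma eval_dehom {k : Type*} [Field k] {N : ℕ} (a : Fin N → k) (f : MvPolynomial (Fin (N + 1)) k) :
    eval a (dehom f) = eval (Fin.cons 1 a) f := by
  have : (aeval a).comp (dehom (k := k) (N := N)) = aeval (Fin.cons 1 a : Fin (N + 1) → k) := by
    ext i
    refine Fin.cases ?_ (fun i => ?_) i <;> simp [dehom]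
  exact congrArg (fun g => g f) this

lemma eval_shiftHom {k : Type*} [Field k] {σ : Type*} (a b : σ → k) (f : MvPolynomial σ k) :
    eval b (shiftHom a f) = eval (b + a) f := by
  have : (aeval b).comp (shiftHom a) = aeval (b + a) := by
    ext i; simp [shiftHom_X]
  exact congrArg (fun g => g f) this

lemma dehom_van {k : Type*} [Field k] {N : ℕ} (p : Fin (N + 1) → k) (hp : p 0 ≠ 0) (m : ℕ)
    (F : MvPolynomial (Fin (N + 1)) k) (hF : F ∈ pointIdeal p ^ m) :
    Van (fun i => p i.succ / p 0) m (dehom F) := by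
  rw [van_iff]
  set a : Fin N → k := fun i => p i.succ / p 0 with ha
  let φ : MvPolynomial (Fin (N + 1)) k →+* MvPolynomial (Fin N) k :=
    ((shiftHom a).comp dehom : MvPolynomial (Fin (N + 1)) k →ₐ[k] MvPolynomial (Fin N) k)
  have h1 : Ideal.map φ (pointIdeal p) ≤
      Ideal.span (X '' ((Finset.univ : Finset (Fin N)) : Set (Fin N))) := by
    rw [Ideal.map_le_iff_le_comap, pointIdeal, Ideal.span_le]
    rintro f ⟨⟨d, hd⟩, hf⟩
    change shiftHom a (dehom f) ∈
      Ideal.span (X '' ((Finset.univ : Finset (Fin N)) : Set (Fin N)))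
    have := (van_iff a 1 (dehom f)).mp (by
      intro b hb
      have hb0 : b = 0 := by
        rw [← Finsupp.degree_eq_zero_iff]; omega
      subst hb0
      have h2 : ∀ g : MvPolynomial (Fin N) k, coeff 0 g = eval 0 g := fun g => by
        rw [← constantCoeff_eq, ← eval_zero]
      rw [h2, eval_shiftHom, zero_add, eval_dehom]
      have h3 : (Fin.cons 1 a : Fin (N + 1) → k) = (p 0)⁻¹ • p := by
        ext i
        refine Fin.cases ?_ (fun i => ?_) i
        · simp [hp]
        · simp [ha, div_eq_inv_mul]
      rw [h3, eval_smul_homog hd, hf, mul_zero])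
    rwa [pow_one] at this
  have h2 := Ideal.mem_map_of_mem φ hF
  rw [Ideal.map_pow] at h2
  exact Ideal.pow_right_mono h1 m h2

lemma dehom_ne_zero {k : Type*} [Field k] [Infinite k] {N t : ℕ}
    {F : MvPolynomial (Fin (N + 1)) k} (hF : F.IsHomogeneous t) (h0 : F ≠ 0) : dehom F ≠ 0 := by
  intro h
  apply mul_ne_zero (X_ne_zero (R := k) (0 : Fin (N + 1))) h0
  refine MvPolynomial.funext fun v => ?_
  rw [map_mul, eval_X, map_zero]
  by_cases hv : v 0 = 0
  · rw [hv, zero_mul]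
  have e : v = v 0 • (Fin.cons 1 fun i => v i.succ / v 0 : Fin (N + 1) → k) := by
    ext i
    refine Fin.cases ?_ (fun i => ?_) i
    · simp
    · simp; field_simp
  have : eval v F = 0 := by
    rw [e, eval_smul_homog hF, ← eval_dehom, h, map_zero, mul_zero]
  rw [this, mul_zero]

lemma dehom_degree {k : Type*} [Field k] {N t : ℕ}
    {F : MvPolynomial (Fin (N + 1)) k} (hF : F.IsHomogeneous t) : (dehom F).totalDegree ≤ t := by
  refine le_trans (totalDegree_aeval_le_of_le_one _ ?_ F) hF.totalDegree_le
  intro i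
  refine Fin.cases ?_ (fun i => ?_) i
  · simp
  · simp

/-- The degree bound needed for the containment. -/
def LB {k : Type*} [Field k] {N n : ℕ} (d : ℕ) (p : Fin n → (Fin (N + 1) → k)) : Prop :=
  ∀ (r t : ℕ) (F : MvPolynomial (Fin (N + 1)) k), F ∈ fatIdeal p (fun _ => 3 * r) →
    F ≠ 0 → F.IsHomogeneous t → r * (d + 3) ≤ t

lemma gen_lower {k : Type*} [Field k] [CharZero k] {n d : ℕ} {c : ℚ}
    (h : HasCfg k 3 c n) (hc : ((d : ℚ) + 3) / 3 < c) : Gen k 3 n (LB d) := by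
  classical
  obtain ⟨T, hT, hW⟩ := h
  obtain ⟨p0, hp0⟩ : ∃ p0 : Fin n → Fin 3 → k, ∀ x ∈ T, ∃ j, p0 j = x := by
    refine ⟨fun j => if hj : (j : ℕ) < T.card then T.equivFin.symm ⟨j, hj⟩ else 0, fun x hx => ?_⟩
    refine ⟨⟨T.equivFin ⟨x, hx⟩, lt_of_lt_of_le (T.equivFin ⟨x, hx⟩).2 hT⟩, ?_⟩
    simp
  obtain ⟨m, hm⟩ : ∃ m : ℕ, ((d : ℚ) + 3) * (m + 2) ≤ 3 * (c * m) := by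
    obtain ⟨m, hm⟩ := exists_nat_ge (2 * ((d : ℚ) + 3) / (3 * c - (d + 3)))
    refine ⟨m, ?_⟩
    have h0 : (0 : ℚ) < 3 * c - (d + 3) := by linarith
    rw [div_le_iff₀ h0] at hm
    linarith
  have hns : NoSmall p0 m ⌈c * m⌉₊ := by
    intro f hf hv
    rw [Nat.ceil_le]
    refine hW f hf m fun x hx => ?_
    obtain ⟨j, rfl⟩ := hp0 x hx
    exact hv j
  obtain ⟨g, hg0, hg⟩ := noSmall_semicont hns
  refine (gen_affine g (by rintro rfl; simp at hg0)).mono ?_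
  rintro p ⟨hp, hpg⟩ r t F hF hF0 hFt
  have h1 := hg (fun j i => p j i.succ / p j 0) hpg
  have h2 := h1.char_zero (dehom F) (dehom_ne_zero hFt hF0) (3 * r)
    fun j => dehom_van (p j) (hp j) _ F ((mem_fat p).mp hF j)
  have h3 := dehom_degree hFt
  have h4 : (d + 3) * (m + 2) ≤ 3 * ⌈c * m⌉₊ := by
    have := Nat.le_ceil (c * m)
    have h5 : ((d : ℚ) + 3) * (m + 2) ≤ 3 * (⌈c * m⌉₊ : ℚ) := by linarith
    exact_mod_cast h5
  have h5 : (m + 2) * (r * (d + 3)) ≤ (m + 2) * t := by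
    calc (m + 2) * (r * (d + 3)) = ((d + 3) * (m + 2)) * r := by ring
      _ ≤ (3 * ⌈c * m⌉₊) * r := Nat.mul_le_mul_right _ h4
      _ = ⌈c * m⌉₊ * (3 * r) := by ring
      _ ≤ _ := h2
      _ ≤ _ := Nat.mul_le_mul_left _ h3
  exact Nat.le_of_mul_le_mul_left h5 (by omega)

lemma choose_three (d : ℕ) : 6 * (d + 2).choose 3 = (d + 2) * (d + 1) * d := by
  have := Nat.descFactorial_eq_factorial_mul_choose (d + 2) 3
  simp [Nat.descFactorial, Nat.factorial] at this
  rw [← this]; ring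

lemma exists_cfg (k : Type*) [Field k] [CharZero k] (d n : ℕ) (hd : 3 ≤ d)
    (hn : (d + 2).choose 3 + 1 ≤ n) : ∃ c : ℚ, HasCfg k 3 c n ∧ ((d : ℚ) + 3) / 3 < c := by
  have h6 := choose_three d
  rcases Nat.lt_or_ge d 7 with h7 | h7
  · interval_cases d
    · exact ⟨_, hasCfg_mono (hasCfg_eleven k) (by omega), by norm_num⟩
    · exact ⟨_, hasCfg_mono (hasCfg_twenty k) (by omega), by norm_num⟩
    · exact ⟨_, hasCfg_mono (hasCfg_box k 3 (by norm_num) 3) (by omega), by norm_num⟩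
    · exact ⟨_, hasCfg_mono (hasCfg_fifty k) (by omega), by norm_num⟩
  · refine ⟨_, hasCfg_mono (hasCfg_box k ((d + 3) / 3 + 1) (by omega) 3) ?_, ?_⟩
    · obtain ⟨s, hs⟩ : ∃ s, s = (d + 3) / 3 + 1 := ⟨_, rfl⟩
      rw [← hs]
      have h3 : 3 * s ≤ d + 6 := by omega
      have h4 : (3 * s) ^ 3 ≤ (d + 6) ^ 3 := Nat.pow_le_pow_left h3 3
      have h5 : 27 * s ^ 3 ≤ 27 * n := by
        obtain ⟨x, rfl⟩ := Nat.exists_eq_add_of_le h7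
        have e1 : 2 * (7 + x + 6) ^ 3 ≤ 9 * ((7 + x + 2) * (7 + x + 1) * (7 + x)) + 54 := by
          have : 9 * ((7 + x + 2) * (7 + x + 1) * (7 + x)) + 54 =
              2 * (7 + x + 6) ^ 3 + (7 * x ^ 3 + 138 * x ^ 2 + 705 * x + 196) := by ring
          omega
        have e2 : (3 * s) ^ 3 = 27 * s ^ 3 := by ring
        omega
      omega
    · have : d + 3 < 3 * ((d + 3) / 3 + 1) := by omega
      have h : ((d : ℚ) + 3) < 3 * (((d + 3) / 3 + 1 : ℕ) : ℚ) := by exact_mod_cast this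
      linarith

/-! ### Five points -/

lemma curve_dvd {k σ : Type*} [Field k] (ψ : σ → Polynomial k) (s c : k) (p : σ → k)
    (h : ∀ l, (ψ l).eval s = c * p l) (m : ℕ) (F : MvPolynomial σ k) (hF : F ∈ pointIdeal p ^ m) :
    (Polynomial.X - Polynomial.C s) ^ m ∣ aeval ψ F := by
  have hev : ∀ f : MvPolynomial σ k, (aeval ψ f : Polynomial k).eval s = eval (c • p) f := by
    intro f
    have : (Polynomial.aeval s).comp (aeval ψ) = (aeval (c • p) : MvPolynomial σ k →ₐ[k] k) := by
      ext l; simp [h]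
    exact congrArg (fun g => g f) this
  let φ : MvPolynomial σ k →+* Polynomial k :=
    (aeval ψ : MvPolynomial σ k →ₐ[k] Polynomial k)
  have h1 : Ideal.map φ (pointIdeal p) ≤ Ideal.span {Polynomial.X - Polynomial.C s} := by
    rw [Ideal.map_le_iff_le_comap, pointIdeal, Ideal.span_le]
    rintro f ⟨⟨d, hd⟩, hf⟩
    change (aeval ψ f : Polynomial k) ∈ Ideal.span {Polynomial.X - Polynomial.C s}
    rw [Ideal.mem_span_singleton, Polynomial.dvd_iff_isRoot, Polynomial.IsRoot, hev,
      eval_smul_homog hd, hf, mul_zero]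
  have h2 := Ideal.mem_map_of_mem φ hF
  rw [Ideal.map_pow] at h2
  have h3 := Ideal.pow_right_mono h1 m h2
  rwa [Ideal.span_singleton_pow, Ideal.mem_span_singleton] at h3

lemma five_points {k : Type*} [Field k] [Infinite k] (b : Fin 4 → Fin 4 → k)
    (hb : ∀ x : Fin 4 → k, ∃ v : Fin 4 → k, ∀ l, x l = ∑ i, v i * b i l)
    (t m : ℕ) (F : MvPolynomial (Fin 4) k) (hF : F.IsHomogeneous t) (h0 : F ≠ 0)
    (h1 : ∀ i, F ∈ pointIdeal (b i) ^ m) (h2 : F ∈ pointIdeal (fun l => ∑ i, b i l) ^ m) :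
    5 * m ≤ 3 * t := by
  classical
  by_contra hlt
  push Not at hlt
  let L : Fin 4 → MvPolynomial (Fin 4) k := fun l => ∑ i, X i * C (b i l)
  have hL : ∀ v, eval v (aeval L F) = eval (fun l => ∑ i, v i * b i l) F := by
    intro v
    have : (aeval v).comp (aeval L) =
        (aeval (fun l => ∑ i, v i * b i l) : MvPolynomial (Fin 4) k →ₐ[k] k) := by
      ext l; simp [L]
    exact congrArg (fun g => g F) this
  have hF' : aeval L F ≠ 0 := by
    intro h
    apply h0
    refine MvPolynomial.funext fun x => ?_
    obtain ⟨v, hv⟩ := hb x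
    rw [funext hv, ← hL, h]; simp
  let Q : MvPolynomial (Fin 4) k := (∏ i, X i) * (∏ i, (X i + 1)) *
    ∏ i, ∏ j ∈ Finset.univ.erase i, (X i - X j)
  have hQ : Q ≠ 0 := by
    refine mul_ne_zero (mul_ne_zero ?_ ?_) ?_
    · exact Finset.prod_ne_zero_iff.mpr fun i _ => X_ne_zero i
    · refine Finset.prod_ne_zero_iff.mpr fun i _ h => ?_
      have := congrArg (eval (fun _ => (0 : k))) h
      simp at this
    · refine Finset.prod_ne_zero_iff.mpr fun i _ => Finset.prod_ne_zero_iff.mpr fun j hj h => ?_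
      have hij : i = j := X_injective (R := k) (sub_eq_zero.mp h)
      simp [hij] at hj
  obtain ⟨v, hv⟩ := exists_eval_ne_zero _ (mul_ne_zero hF' hQ)
  rw [map_mul, map_mul, map_mul] at hv
  have hv1 := left_ne_zero_of_mul hv
  have hv2 : ∀ i, v i ≠ 0 := by
    have := left_ne_zero_of_mul (left_ne_zero_of_mul (right_ne_zero_of_mul hv))
    rw [map_prod] at this
    intro i
    simpa using Finset.prod_ne_zero_iff.mp this i (Finset.mem_univ i)
  have hv3 : ∀ i, v i + 1 ≠ 0 := by
    have := right_ne_zero_of_mul (left_ne_zero_of_mul (right_ne_zero_of_mul hv))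
    rw [map_prod] at this
    intro i
    simpa using Finset.prod_ne_zero_iff.mp this i (Finset.mem_univ i)
  have hv4 : Function.Injective v := by
    have := right_ne_zero_of_mul (right_ne_zero_of_mul hv)
    rw [map_prod] at this
    intro i j hij
    by_contra hne
    have h := Finset.prod_ne_zero_iff.mp this i (Finset.mem_univ i)
    rw [map_prod] at h
    have h' := Finset.prod_ne_zero_iff.mp h j (by simp [Ne.symm hne])
    simp [hij] at h'
  let a : Fin 4 → k := fun i => v i / (v i + 1)
  have ha0 : ∀ i, a i ≠ 0 := fun i => div_ne_zero (hv2 i) (hv3 i)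
  have ha : Function.Injective a := by
    intro i j hij
    apply hv4
    have := (div_eq_div_iff (hv3 i) (hv3 j)).mp hij
    linear_combination this
  have ha1 : ∀ i, 1 - a i = (v i + 1)⁻¹ := by
    intro i
    have := hv3 i
    simp only [a]
    field_simp
    ring
  let ψ : Fin 4 → Polynomial k := fun l => ∑ i, Polynomial.C (a i * b i l) *
    ∏ j ∈ Finset.univ.erase i, (Polynomial.X - Polynomial.C (a j))
  have hψ : ∀ s l, (ψ l).eval s = ∑ i, a i * b i l * ∏ j ∈ Finset.univ.erase i, (s - a j) := by
    intro s l
    simp only [ψ, Polynomial.eval_finsetSum, Polynomial.eval_mul, Polynomial.eval_C,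
      Polynomial.eval_prod, Polynomial.eval_sub, Polynomial.eval_X]
  have hdeg : ∀ l, (ψ l).natDegree ≤ 3 := by
    intro l
    refine Polynomial.natDegree_sum_le_of_forall_le _ _ fun i _ => ?_
    refine (Polynomial.natDegree_C_mul_le _ _).trans ((Polynomial.natDegree_prod_le _ _).trans ?_)
    simp
  have hd1 : ∀ i, (Polynomial.X - Polynomial.C (a i)) ^ m ∣ aeval ψ F := by
    intro i
    refine curve_dvd ψ (a i) (a i * ∏ j ∈ Finset.univ.erase i, (a i - a j)) (b i) ?_ m F (h1 i)
    intro l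
    rw [hψ, Finset.sum_eq_single i]
    · ring
    · intro j _ hj
      rw [Finset.prod_eq_zero (i := i) (by simp [Ne.symm hj]) (sub_self _), mul_zero]
    · simp
  have hd2 : (Polynomial.X - Polynomial.C 0) ^ m ∣ aeval ψ F := by
    refine curve_dvd ψ 0 (-∏ j, a j) _ ?_ m F h2
    intro l
    rw [hψ, Finset.mul_sum]
    refine Finset.sum_congr rfl fun i _ => ?_
    rw [← Finset.mul_prod_erase Finset.univ a (Finset.mem_univ i)]
    simp only [zero_sub, Finset.prod_neg]
    simp
    ring
  let z : Fin 5 → k := Fin.cons 0 a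
  have hz : Function.Injective z := by
    rw [Fin.cons_injective_iff]
    exact ⟨by rintro ⟨i, hi⟩; exact ha0 i hi, ha⟩
  have hd : ∏ i, (Polynomial.X - Polynomial.C (z i)) ^ m ∣ aeval ψ F := by
    refine Finset.prod_dvd_of_coprime ?_ ?_
    · intro i _ j _ hij
      exact (Polynomial.pairwise_coprime_X_sub_C hz hij).pow
    · intro i _
      refine Fin.cases ?_ (fun i => ?_) i
      · exact hd2
      · exact hd1 i
  have hzero : (aeval ψ F : Polynomial k) = 0 := by
    refine Polynomial.eq_zero_of_dvd_of_natDegree_lt hd ?_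
    refine lt_of_le_of_lt (aeval_natDegree_le F hF.totalDegree_le ψ hdeg) ?_
    rw [Polynomial.natDegree_prod_of_monic _ _ fun i _ => (Polynomial.monic_X_sub_C _).pow _]
    simp
    omega
  apply hv1
  rw [hL]
  have hev : (aeval ψ F : Polynomial k).eval 1 = eval (fun l => (ψ l).eval 1) F := by
    have : (Polynomial.aeval (1 : k)).comp (aeval ψ) =
        (aeval (fun l => (ψ l).eval 1) : MvPolynomial (Fin 4) k →ₐ[k] k) := by
      ext l; simp
    exact congrArg (fun g => g F) this
  have h6 : (fun l => (ψ l).eval 1) = (∏ j, (v j + 1)⁻¹) • (fun l => ∑ i, v i * b i l) := by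
    funext l
    rw [hψ, Pi.smul_apply, smul_eq_mul, Finset.mul_sum]
    refine Finset.sum_congr rfl fun i _ => ?_
    simp only [ha1]
    rw [← Finset.mul_prod_erase Finset.univ (fun j => (v j + 1)⁻¹) (Finset.mem_univ i)]
    simp only [a, div_eq_mul_inv]
    ring
  rw [hzero, Polynomial.eval_zero, h6, eval_smul_homog hF] at hev
  refine (mul_eq_zero.mp hev.symm).resolve_left (pow_ne_zero _ ?_)
  exact Finset.prod_ne_zero_iff.mpr fun i _ => inv_ne_zero (hv3 i)

lemma gen_lower_two (k : Type*) [Field k] [Infinite k] (n : ℕ) (hn : 5 ≤ n) :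
    Gen k 3 n (LB 2) := by
  classical
  let ι : Fin 4 → Fin n := fun i => ⟨i, by omega⟩
  let q4 : Fin n := ⟨4, by omega⟩
  let A : Matrix (Fin 4) (Fin 4) (MvPolynomial (Fin n × Fin (3 + 1)) k) :=
    Matrix.of fun l i => X (ι i, l)
  let B : Fin 4 → MvPolynomial (Fin n × Fin (3 + 1)) k := fun l => X (q4, l)
  let g := A.det * ∏ i, (A.adjugate.mulVec B) i
  have hev : ∀ p : Fin n → Fin (3 + 1) → k, eval (fun q => p q.1 q.2) g =
      (Matrix.of fun l i => p (ι i) l : Matrix (Fin 4) (Fin 4) k).det *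
      ∏ i, ((Matrix.of fun l i => p (ι i) l : Matrix (Fin 4) (Fin 4) k).adjugate.mulVec (p q4)) i := by
    intro p
    have hA : (eval (fun q : Fin n × Fin (3 + 1) => p q.1 q.2)).mapMatrix A =
        (Matrix.of fun l i => p (ι i) l : Matrix (Fin 4) (Fin 4) k) := by
      ext l i; simp [A]
    have hB : (eval (fun q : Fin n × Fin (3 + 1) => p q.1 q.2)) ∘ B = p q4 := by
      ext l; simp [B]
    rw [map_mul, RingHom.map_det, hA, map_prod]
    congr 1
    refine Finset.prod_congr rfl fun i _ => ?_
    rw [RingHom.map_mulVec, hB, ← hA, ← RingHom.map_adjugate]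
    rfl
  refine ⟨g, ?_, fun p hp => ?_⟩
  · intro h0
    have := hev (fun j l => if (j : ℕ) = 4 then 1 else if (j : ℕ) = l then 1 else 0)
    have e : (Matrix.of fun l i => (fun (j : Fin n) (l : Fin (3 + 1)) => if (j : ℕ) = 4 then (1 : k)
        else if (j : ℕ) = l then 1 else 0) (ι i) l : Matrix (Fin 4) (Fin 4) k) = 1 := by
      ext l i
      have : (i : ℕ) ≠ 4 := by omega
      simp only [Matrix.of_apply, ι, this, if_false, Matrix.one_apply, Fin.ext_iff]
      simp only [eq_comm]
    rw [e, h0] at this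
    simp [q4] at this
  · rw [hev] at hp
    set P : Matrix (Fin 4) (Fin 4) k := Matrix.of fun l i => p (ι i) l with hP
    have hdet := left_ne_zero_of_mul hp
    set c := P.adjugate.mulVec (p q4) with hc
    have hc0 : ∀ i, c i ≠ 0 := fun i =>
      Finset.prod_ne_zero_iff.mp (right_ne_zero_of_mul hp) i (Finset.mem_univ i)
    intro r t F hF hF0 hFt
    rw [mem_fat] at hF
    have hs : (fun l => ∑ i, (c i • p (ι i)) l) = P.det • p q4 := by
      have h1 : P.mulVec c = P.det • p q4 := by
        rw [hc, Matrix.mulVec_mulVec, Matrix.mul_adjugate, Matrix.smul_mulVec, Matrix.one_mulVec]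
      rw [← h1]
      funext l
      simp [Matrix.mulVec, dotProduct, hP, mul_comm]
    have := five_points (fun i => c i • p (ι i)) ?_ t (3 * r) F hFt hF0 ?_ ?_
    · omega
    · intro x
      refine ⟨fun i => (P⁻¹.mulVec x) i / c i, fun l => ?_⟩
      have h1 : P.mulVec (P⁻¹.mulVec x) = x := by
        rw [Matrix.mulVec_mulVec, Matrix.mul_nonsing_inv _ (isUnit_iff_ne_zero.mpr hdet),
          Matrix.one_mulVec]
      conv_lhs => rw [← h1]
      rw [Matrix.mulVec, dotProduct]
      refine Finset.sum_congr rfl fun i _ => ?_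
      have := hc0 i
      simp only [hP, Matrix.of_apply, Pi.smul_apply, smul_eq_mul]
      field_simp
    · intro i
      rw [pointIdeal_smul _ (hc0 i)]
      exact hF (ι i)
    · rw [hs, pointIdeal_smul _ hdet]
      exact hF q4

/-! ### At most four points -/

lemma exists_split (J : Finset (Fin 4)) (hJ : J.Nonempty) (r : ℕ) (a : Fin 4 →₀ ℕ)
    (h : ∀ j ∈ J, 3 * (r + 1) + a j ≤ a.degree) :
    ∃ u w v : Fin 4 →₀ ℕ, a = u + w + v ∧ w.degree = 2 ∧ (∀ j ∈ J, 3 * r + v j ≤ v.degree) ∧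
      ((∃ i, i ∉ J ∧ u = Finsupp.single i 1) ∨
        ∃ i j, i ≠ j ∧ u = Finsupp.single i 1 + Finsupp.single j 1) := by
  classical
  by_cases hs : a.support ⊆ J
  · have hsum : a.support.card * (3 * (r + 1)) + a.degree ≤ a.support.card * a.degree := by
      have h1 : ∑ j ∈ a.support, (3 * (r + 1) + a j) ≤ ∑ j ∈ a.support, a.degree :=
        Finset.sum_le_sum fun j hj => h j (hs hj)
      rw [Finset.sum_add_distrib, Finset.sum_const, Finset.sum_const, smul_eq_mul,
        smul_eq_mul] at h1
      exact h1
    have hcard : a.support.card ≤ 4 := by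
      simpa using Finset.card_le_univ a.support
    have hpos : 3 * (r + 1) ≤ a.degree := by
      obtain ⟨j, hj⟩ := hJ
      have := h j hj
      omega
    have h2 : 2 ≤ a.support.card := by
      by_contra hlt
      have : a.support.card = 0 ∨ a.support.card = 1 := by omega
      rcases this with e | e <;> rw [e] at hsum <;> omega
    have hdeg : 4 * (r + 1) ≤ a.degree := by
      generalize a.support.card = c at *
      interval_cases c <;> omega
    obtain ⟨i, hi, j, hj, hij⟩ := Finset.one_lt_card.mp h2
    let w0 : Fin 4 →₀ ℕ := ∑ l ∈ a.support, Finsupp.single l 1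
    have hw0 : ∀ l, w0 l = if l ∈ a.support then 1 else 0 := by
      intro l
      simp [w0, Finsupp.finsetSum_apply, Finsupp.single_apply]
    have hw0a : w0 ≤ a := by
      intro l
      rw [hw0]
      split_ifs with hl
      · rw [Finsupp.mem_support_iff] at hl; omega
      · omega
    have hw0d : w0.degree = a.support.card := by
      simp [w0, map_sum]
    have e1 : w0 + (a - w0) = a := add_tsub_cancel_of_le hw0a
    have e1d : w0.degree + (a - w0).degree = a.degree := by rw [← map_add, e1]
    obtain ⟨u1, v, huv, hu1⟩ := exists_le_degree (a - w0) (4 - a.support.card) (by omega)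
    have e2 : Finsupp.single i 1 + Finsupp.single j 1 ≤ w0 := by
      intro l
      rw [hw0, Finsupp.add_apply, Finsupp.single_apply, Finsupp.single_apply]
      by_cases h1 : i = l
      · subst h1; simp [hi, Ne.symm hij]
      · by_cases h2 : j = l
        · subst h2; simp [hj, hij]
        · simp [h1, h2]
    have e3 : Finsupp.single i 1 + Finsupp.single j 1 +
        (w0 - (Finsupp.single i 1 + Finsupp.single j 1)) = w0 := add_tsub_cancel_of_le e2
    have e3d : 2 + (w0 - (Finsupp.single i 1 + Finsupp.single j 1)).degree = w0.degree := by
      conv_rhs => rw [← e3]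
      rw [map_add, map_add, Finsupp.degree_single, Finsupp.degree_single]
    refine ⟨Finsupp.single i 1 + Finsupp.single j 1,
      (w0 - (Finsupp.single i 1 + Finsupp.single j 1)) + u1, v, ?_, ?_, ?_, Or.inr ⟨i, j, hij, rfl⟩⟩
    · rw [← add_assoc, e3, add_assoc, huv, e1]
    · rw [map_add]; omega
    · intro l hl
      have h3 := h l hl
      have h4 : a.degree = v.degree + 4 := by
        rw [← e1d, ← huv, map_add]; omega
      have h5 : w0 l + (u1 l + v l) = a l := by
        rw [← Finsupp.add_apply, huv, ← Finsupp.add_apply, e1]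
      have h6 := hw0 l
      by_cases hla : l ∈ a.support
      · rw [if_pos hla] at h6; omega
      · have := Finsupp.notMem_support_iff.mp hla
        omega
  · obtain ⟨i, hi, hiJ⟩ := Finset.not_subset.mp hs
    rw [Finsupp.mem_support_iff] at hi
    obtain ⟨b, hb, hbd⟩ := exists_single_add a i hi
    have hpos : 3 * (r + 1) ≤ a.degree := by
      obtain ⟨j, hj⟩ := hJ
      have := h j hj
      omega
    obtain ⟨w, v, hwv, hw⟩ := exists_le_degree b 2 (by omega)
    refine ⟨Finsupp.single i 1, w, v, ?_, hw, ?_, Or.inl ⟨i, hiJ, rfl⟩⟩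
    · rw [hb, ← hwv, add_comm (w + v), add_assoc]
    · intro l hl
      have h3 := h l hl
      have h4 : b.degree = 2 + v.degree := by rw [← hwv, map_add, hw]
      have h5 : v l ≤ a l := by
        rw [hb, ← hwv]; simp
        omega
      omega

lemma monomial_mem {k : Type*} [Field k] (J : Finset (Fin 4)) (hJ : J.Nonempty)
    (I : Ideal (MvPolynomial (Fin (3 + 1)) k)) (h1 : ∀ i, i ∉ J → X i ∈ I)
    (h2 : ∀ i j, i ≠ j → X i * X j ∈ I) (r : ℕ) : ∀ a : Fin 4 →₀ ℕ,
    (∀ j ∈ J, 3 * r + a j ≤ a.degree) → monomial a (1 : k) ∈ maxIdeal k 3 ^ (2 * r) * I ^ r := by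
  induction r with
  | zero => intro a _; simp
  | succ r ih =>
    intro a ha
    obtain ⟨u, w, v, rfl, hw, hv, hu⟩ := exists_split J hJ r a ha
    have e : (monomial (u + w + v) (1 : k)) = (monomial w 1 * monomial v 1) * monomial u 1 := by
      have e0 : u + w + v = w + v + u := by rw [add_assoc u w v, add_comm u (w + v)]
      rw [monomial_mul, monomial_mul, one_mul, one_mul, e0]
    have hu' : monomial u (1 : k) ∈ I := by
      rcases hu with ⟨i, hi, rfl⟩ | ⟨i, j, hij, rfl⟩
      · exact h1 i hi
      · have := h2 i j hij
        rwa [X, X, monomial_mul, one_mul] at this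
    rw [e, pow_succ, ← mul_assoc]
    refine Ideal.mul_mem_mul ?_ hu'
    have e2 : 2 * (r + 1) = 2 + 2 * r := by ring
    rw [e2, pow_add, mul_assoc]
    exact Ideal.mul_mem_mul (homog_mem_maxIdeal_pow (isHomogeneous_monomial _ rfl) hw.ge) (ih v hv)

/-- Linear substitution. -/
noncomputable def linHom {k : Type*} [Field k] {s : ℕ} (B : Matrix (Fin s) (Fin s) k) :
    MvPolynomial (Fin s) k →ₐ[k] MvPolynomial (Fin s) k :=
  aeval fun i => ∑ j, C (B j i) * X j

lemma linHom_comp {k : Type*} [Field k] {s : ℕ} (A B : Matrix (Fin s) (Fin s) k) (h : A * B = 1) :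
    (linHom A).comp (linHom B) = AlgHom.id k _ := by
  ext i : 1
  have h1 : ∀ l, ∑ j, A l j * B j i = if l = i then 1 else 0 := fun l => by
    have := congrFun (congrFun h l) i
    rwa [Matrix.mul_apply, Matrix.one_apply] at this
  have h2 : linHom A (linHom B (X i)) = ∑ l, C (∑ j, A l j * B j i) * X l := by
    simp only [linHom, aeval_X, map_sum, map_mul, aeval_C, algebraMap_eq, Finset.mul_sum,
      Finset.sum_mul]
    rw [Finset.sum_comm]
    refine Finset.sum_congr rfl fun l _ => Finset.sum_congr rfl fun j _ => ?_
    ring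
  rw [AlgHom.comp_apply, h2]
  simp only [h1]
  simp

lemma linHom_homog {k : Type*} [Field k] {s : ℕ} (B : Matrix (Fin s) (Fin s) k) (i : Fin s) :
    (linHom B (X i)).IsHomogeneous 1 := by
  rw [linHom, aeval_X]
  exact IsHomogeneous.sum _ _ _ fun j _ => isHomogeneous_C_mul_X _ _

lemma gen_four (k : Type*) [Field k] (n : ℕ) (hn : 1 ≤ n) (hn4 : n ≤ 4) :
    Gen k 3 n (fun p => ∀ r : ℕ, 1 ≤ r → fatIdeal p (fun _ => 3 * r) ≤
          maxIdeal k 3 ^ (2 * r) * (fatIdeal p (fun _ => 1)) ^ r) := by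
  classical
  let P : Matrix (Fin 4) (Fin 4) (MvPolynomial (Fin n × Fin (3 + 1)) k) :=
    Matrix.of fun j i => if h : (j : ℕ) < n then X (⟨j, h⟩, i) else if i = j then 1 else 0
  have hev : ∀ p : Fin n → Fin (3 + 1) → k, eval (fun q => p q.1 q.2) P.det =
      (Matrix.of fun j i => if h : (j : ℕ) < n then p ⟨j, h⟩ i else if i = j then 1 else 0 :
        Matrix (Fin 4) (Fin 4) k).det := by
    intro p
    rw [RingHom.map_det]
    congr 1
    ext j i
    simp only [P, RingHom.mapMatrix_apply, Matrix.map_apply, Matrix.of_apply]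
    split_ifs <;> simp
  refine ⟨P.det, ?_, fun p hp r hr F hF => ?_⟩
  · intro h0
    have := hev (fun j i => if (i : ℕ) = j then 1 else 0)
    have e : (Matrix.of fun j i => if h : (j : ℕ) < n then (fun (j : Fin n) (i : Fin (3 + 1)) =>
        if (i : ℕ) = j then (1 : k) else 0) ⟨j, h⟩ i else if i = j then 1 else 0 :
        Matrix (Fin 4) (Fin 4) k) = 1 := by
      ext j i
      simp only [Matrix.of_apply, Matrix.one_apply, Fin.ext_iff]
      simp [eq_comm]
    rw [e, h0] at this
    simp at this
  · rw [hev] at hp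
    set B : Matrix (Fin 4) (Fin 4) k :=
      Matrix.of fun j i => if h : (j : ℕ) < n then p ⟨j, h⟩ i else if i = j then 1 else 0 with hB
    have hu : IsUnit B.det := isUnit_iff_ne_zero.mpr hp
    let τ : MvPolynomial (Fin 4) k ≃ₐ[k] MvPolynomial (Fin 4) k :=
      AlgEquiv.ofAlgHom (linHom B) (linHom B⁻¹) (linHom_comp _ _ (Matrix.mul_nonsing_inv _ hu))
        (linHom_comp _ _ (Matrix.nonsing_inv_mul _ hu))
    let ι : Fin n → Fin 4 := fun j => ⟨j, by omega⟩
    have key : ∀ (j : Fin n) (m : ℕ) (G : MvPolynomial (Fin 4) k), G ∈ pointIdeal (p j) ^ m ↔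
        ∀ b ∈ (τ G).support, m ≤ ∑ i ∈ Finset.univ.erase (ι j), b i := by
      intro j m G
      refine mem_pointIdeal_pow_iff τ (fun i => linHom_homog B i) (fun i => linHom_homog B⁻¹ i)
        (p j) (ι j) ?_ m G
      intro i
      change eval _ (linHom B (X i)) = _
      simp only [linHom, aeval_X, map_sum, map_mul, eval_C, eval_X]
      rw [Finset.sum_eq_single (ι j)]
      · simp [hB, ι]
      · intro l _ hl
        simp [hl]
      · simp
    have hdeg : ∀ (b : Fin 4 →₀ ℕ) j, b.degree = b j + ∑ i ∈ Finset.univ.erase j, b i := by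
      intro b j
      rw [Finsupp.degree_eq_sum, Finset.add_sum_erase _ _ (Finset.mem_univ j)]
    let φ : MvPolynomial (Fin 4) k →+* MvPolynomial (Fin 4) k := τ.symm
    have hφτ : ∀ G, φ (τ G) = G := fun G => τ.symm_apply_apply G
    have hτφ : ∀ G, τ (φ G) = G := fun G => τ.apply_symm_apply G
    let I' : Ideal (MvPolynomial (Fin 4) k) := Ideal.comap φ (fatIdeal p (fun _ => 1))
    have hI' : ∀ u : Fin 4 →₀ ℕ, (∀ j : Fin n, ∃ i, i ≠ ι j ∧ u i ≠ 0) → monomial u (1 : k) ∈ I' := by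
      intro u hu
      rw [Ideal.mem_comap, mem_fat]
      intro j
      rw [key, hτφ]
      intro b hb
      have : b = u := by simpa using support_monomial_subset hb
      subst this
      obtain ⟨i, hi, hbi⟩ := hu j
      have := Finset.single_le_sum (f := fun i => b i) (fun _ _ => Nat.zero_le _)
        (Finset.mem_erase.mpr ⟨hi, Finset.mem_univ i⟩)
      have h3 : b i ≤ ∑ i ∈ Finset.univ.erase (ι j), b i := this
      omega
    have hmap : Ideal.map φ (maxIdeal k 3 ^ (2 * r) * I' ^ r) ≤
        maxIdeal k 3 ^ (2 * r) * fatIdeal p (fun _ => 1) ^ r := by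
      rw [Ideal.map_mul, Ideal.map_pow, Ideal.map_pow]
      refine Ideal.mul_mono (Ideal.pow_right_mono ?_ _) (Ideal.pow_right_mono Ideal.map_comap_le _)
      rw [maxIdeal, Ideal.map_span, Ideal.span_le]
      rintro _ ⟨_, ⟨i, rfl⟩, rfl⟩
      have := homog_mem_maxIdeal_pow (N := 3) (q := 1) (linHom_homog B⁻¹ i) le_rfl
      rw [pow_one] at this
      exact this
    rw [← hφτ F]
    refine hmap (Ideal.mem_map_of_mem φ ?_)
    rw [(τ F).as_sum]
    refine Ideal.sum_mem _ fun a ha => ?_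
    have e : monomial a (coeff a (τ F)) = C (coeff a (τ F)) * monomial a 1 := by
      rw [C_mul_monomial, mul_one]
    rw [e]
    refine Ideal.mul_mem_left _ _ (monomial_mem (Finset.univ.image ι) ?_ I' ?_ ?_ r a ?_)
    · exact ⟨ι ⟨0, by omega⟩, by simp⟩
    · intro i hi
      refine hI' _ fun j => ⟨i, ?_, by simp⟩
      rintro rfl
      simp at hi
    · intro i j hij
      have := hI' (Finsupp.single i 1 + Finsupp.single j 1) (fun l => by
        by_cases h : i = ι l
        · exact ⟨j, fun h' => hij (h.trans h'.symm), by simp⟩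
        · exact ⟨i, h, by simp⟩)
      rwa [X, X, monomial_mul, one_mul]
    · intro j hj
      obtain ⟨j, -, rfl⟩ := Finset.mem_image.mp hj
      have := (key j (3 * r) F).mp ((mem_fat p).mp hF j) a ha
      rw [hdeg a (ι j)]
      omega

/-! ### Assembly -/

lemma containment {k : Type*} [Field k] {N n d : ℕ} (p : Fin n → (Fin (N + 1) → k))
    (hp : ∀ j, p j 0 ≠ 0) (hLB : LB d p)
    (e : Fin n → MvPolynomial (Fin (N + 1)) k) (he : ∀ j, (e j).IsHomogeneous d)
    (hd : ∀ i j, eval (p i) (e j) = if i = j then 1 else 0) (r : ℕ) :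
    fatIdeal p (fun _ => 3 * r) ≤ maxIdeal k N ^ (2 * r) * (fatIdeal p (fun _ => 1)) ^ r := by
  refine le_of_homog (fatIdeal_homog _ _) fun F hF t ht => ?_
  by_cases hF0 : F = 0
  · rw [hF0]; exact Ideal.zero_mem _
  have hlb := hLB r t F hF hF0 ht
  let p' : Fin n → (Fin (N + 1) → k) := fun j => (p j 0)⁻¹ • p j
  have hfat : ∀ m, fatIdeal p' m = fatIdeal p m := by
    intro m
    unfold fatIdeal
    refine iInf_congr fun j => ?_
    rw [pointIdeal_smul _ (inv_ne_zero (hp j))]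
  rw [← hfat]
  refine regularity (p := p') (d := d) (e := fun j => C (p j 0 ^ d) * e j) ?_ ?_ ?_ r (2 * r) t F
    ?_ ht ?_
  · intro j
    simp [p', hp j]
  · exact fun j => (he j).C_mul _
  · intro i j
    rw [map_mul, eval_C, eval_smul_homog (he j), hd]
    by_cases hij : i = j
    · subst hij
      have := hp i
      simp [this]
    · simp [hij]
  · rw [hfat]
    exact fat_anti p (by omega) hF
  · have : r * (d + 1) + 2 * r = r * (d + 3) := by ring
    omega

lemma gen_main (k : Type*) [Field k] [CharZero k] (n : ℕ) (hn : 5 ≤ n) :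
    Gen k 3 n (fun p => ∀ r : ℕ, 1 ≤ r → fatIdeal p (fun _ => 3 * r) ≤
          maxIdeal k 3 ^ (2 * r) * (fatIdeal p (fun _ => 1)) ^ r) := by
  classical
  have hex : ∃ d, n ≤ (d + 3).choose 3 := by
    refine ⟨n, ?_⟩
    have := choose_three (n + 1)
    have h2 : n + 1 + 2 = n + 3 := by omega
    rw [h2] at this
    have h3 : (n + 3) * (n + 1 + 1) * (n + 1) = n ^ 3 + 6 * n ^ 2 + 11 * n + 6 := by ring
    omega
  obtain ⟨d, hd, hmin⟩ : ∃ d, n ≤ (d + 3).choose 3 ∧ ∀ d' < d, (d' + 3).choose 3 < n :=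
    ⟨Nat.find hex, Nat.find_spec hex, fun d' h => not_le.mp (Nat.find_min hex h)⟩
  have hd2 : 2 ≤ d := by
    by_contra hlt
    have : d = 0 ∨ d = 1 := by omega
    rcases this with rfl | rfl
    · simp at hd; omega
    · have : (1 + 3).choose 3 = 4 := by decide
      omega
  have hLB : Gen k 3 n (LB d) := by
    rcases Nat.eq_or_lt_of_le hd2 with rfl | h3
    · exact gen_lower_two k n hn
    · obtain ⟨c, hc1, hc2⟩ := exists_cfg k d n h3 (by
        have := hmin (d - 1) (by omega)
        have e : d - 1 + 3 = d + 2 := by omega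
        rw [e] at this
        omega)
      exact gen_lower hc1 hc2
  refine (((gen_zero_ne k 3 n).and hLB).and (gen_sep k n d hd)).mono ?_
  rintro p ⟨⟨h1, h2⟩, e, h3, h4⟩ r -
  exact containment p h1 h2 e h3 h4 r

/-- For every `n ≥ 1` and points `p₁, …, pₙ` in general position in `ℙ³`, the radical
ideal `I = ⋂ⱼ m_{pⱼ}` satisfies `I^(3r) ⊆ M^(2r) * I^r` for all `r ≥ 1`. -/
theorem statement0 (k : Type*) [Field k] [CharZero k] (n : ℕ) (hn : 1 ≤ n) :
    Generic k 3 n (fun p =>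
      ∀ r : ℕ, 1 ≤ r →
        fatIdeal p (fun _ => 3 * r) ≤
          maxIdeal k 3 ^ (2 * r) * (fatIdeal p (fun _ => 1)) ^ r) := by
  rcases Nat.lt_or_ge 4 n with h | h
  · exact (gen_main k n h).generic
  · exact (gen_four k n hn h).generic
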